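/- In the Weyl group $W_n$ of type $B_n/C_n$ with $n = 2c+1$ odd, the $j$-induction of the sign representation from the reflection subgroup $W_c \times W'_{c+1}$ equals the $j$-induction of the sign representation from $S_n$, and both equal the irreducible representation with symbol $[(1<2<3<\dots<c+1),(1<2<3<\dots<c)]$. -/

import Mathlib

open Finset Equiv

namespace CS

noncomputable section

/-- Inner product of class functions on a finite group. -/
def cinner {G : Type} [Group G] (φ ψ : G → ℂ) : ℂ :=
  (Nat.card G : ℂ)⁻¹ * ∑ᶠ g : G, φ g * ψ g⁻¹

/-- The character of the `d`-th symmetric power of a representation with character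
`χ`, computed via Newton's recursion
`d·χ_{Sym^d}(g) = ∑_{k=1}^{d} χ(g^k) χ_{Sym^{d-k}}(g)`. -/
def symChar {G : Type} [Group G] (χ : G → ℂ) : ℕ → G → ℂ
  | 0, _ => 1
  | (d+1), g => ((d : ℂ) + 1)⁻¹ *
      ∑ k ∈ Finset.range (d + 1), χ (g ^ (k + 1)) * symChar χ (d - k) g
  termination_by d _ => d
  decreasing_by omega

/-- Induction of class functions from a subgroup `H` to a subgroup `K` (of an ambient
group `G`), by the usual induced-character formula. -/
def indChar {G : Type} [Group G] (H K : Subgroup G) (φ : H → ℂ) : K → ℂ :=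
  open scoped Classical in
  fun g => (Nat.card H : ℂ)⁻¹ *
    ∑ᶠ x : K, if h : ((x : G) * g * (x : G)⁻¹) ∈ H then φ ⟨_, h⟩ else 0

/-- Restriction of a class function on the ambient group to a subgroup. -/
def resChar {G : Type} [Group G] (H : Subgroup G) (χ : G → ℂ) : H → ℂ :=
  fun h => χ h

/-- Restriction of a class function from a subgroup `K` to a subgroup `H` (junk value
`0` off `K`; meaningful when `H ≤ K`). -/
def resSub {G : Type} [Group G] (H K : Subgroup G) (χ : K → ℂ) : H → ℂ :=
  open scoped Classical in
  fun h => if hh : (h : G) ∈ K then χ ⟨_, hh⟩ else 0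

/-- `χ` is the character of a (finite-dimensional, complex) representation. -/
def IsChar {G : Type} [Group G] (χ : G → ℂ) : Prop :=
  ∃ (V : Type) (_ : AddCommGroup V) (_ : Module ℂ V) (ρ : Representation ℂ G V),
    FiniteDimensional ℂ V ∧ ∀ g, χ g = LinearMap.trace ℂ V (ρ g)

/-- `χ` is an irreducible character: a genuine character of norm one. -/
def IsIrrChar {G : Type} [Group G] (χ : G → ℂ) : Prop :=
  IsChar χ ∧ cinner χ χ = 1

/-- Multiplicity of `χE` in the `d`-th symmetric power of the reflection
representation (with character `χR`). -/
def bMult {G : Type} [Group G] (χR χE : G → ℂ) (d : ℕ) : ℂ :=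
  cinner χE (symChar χR d)

/-- `b` is the `b`-invariant of `χE`: the least degree of the symmetric algebra of
the reflection representation containing `χE`. -/
def IsBAt {G : Type} [Group G] (χR χE : G → ℂ) (b : ℕ) : Prop :=
  bMult χR χE b ≠ 0 ∧ ∀ d < b, bMult χR χE d = 0

/-- `χE = j_H^K (χE')` (GP 5.2.6): `χE` is an irreducible character of `K` occurring
in the induction of `χE'` from `H`, with the same `b`-invariant as `χE'`, where `χE'`
occurs with multiplicity one in the corresponding symmetric power for `H`; the
reflection characters of `H` and `K` are the restrictions of the ambient reflection
character `χR`. -/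
def IsJInd {G : Type} [Group G] (χR : G → ℂ) (H K : Subgroup G)
    (χE' : H → ℂ) (χE : K → ℂ) : Prop :=
  IsIrrChar χE ∧ cinner χE (indChar H K χE') ≠ 0 ∧
  ∃ b, IsBAt (resChar H χR) χE' b ∧ bMult (resChar H χR) χE' b = 1 ∧
    IsBAt (resChar K χR) χE b

/-! ### The hyperoctahedral group and its reflection subgroups.

We realize `W_n` (type `B_n/C_n`) as the permutations of `Fin n ⊕ Fin n`
(thought of as `{1,…,n} ⊔ {-1,…,-n}`) generated by the reflections below; `W'_n`
(type `D_n`) and the various reflection subgroups are likewise generated by the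
appropriate reflections. -/

/-- Ambient permutation group of the `2n` points. -/
abbrev PG (n : ℕ) := Equiv.Perm (Fin n ⊕ Fin n)

/-- The reflection-representation matrix of a signed permutation. -/
def Mrefl {n : ℕ} (π : PG n) : Matrix (Fin n) (Fin n) ℂ :=
  Matrix.of fun j i =>
    (if π (Sum.inl i) = Sum.inl j then 1 else 0) -
      (if π (Sum.inl i) = Sum.inr j then 1 else 0)

/-- The character of the reflection representation (on signed permutations). -/
def reflChar {n : ℕ} : PG n → ℂ := fun π => (Mrefl π).trace

/-- The sign (determinant) character of the reflection representation. -/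
def sgnChar {n : ℕ} : PG n → ℂ := fun π => (Mrefl π).det

/-- The reflection `(e_i ↔ e_j)` (a double transposition). -/
def dsw {n : ℕ} (i j : Fin n) : PG n :=
  Equiv.swap (Sum.inl i) (Sum.inl j) * Equiv.swap (Sum.inr i) (Sum.inr j)

/-- The reflection `e_i ↦ -e_i` (a sign change). -/
def ssw {n : ℕ} (i : Fin n) : PG n := Equiv.swap (Sum.inl i) (Sum.inr i)

/-- The reflection `e_i ↦ -e_j, e_j ↦ -e_i`. -/
def msw {n : ℕ} (i j : Fin n) : PG n :=
  Equiv.swap (Sum.inl i) (Sum.inr j) * Equiv.swap (Sum.inr i) (Sum.inl j)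

/-- Types of blocks: symmetric group (`A`-type), hyperoctahedral (`B`-type),
even-signed (`D`-type). -/
inductive BTy | S | B | D
deriving DecidableEq

/-- The reflection subgroup of `W_n` determined by a block structure: `f` assigns to
each index its block, `ty` the type of each index.  On an `S`-block only the
transpositions `dsw` act, on a `B`-block also the sign changes, on a `D`-block the
`dsw` and the `msw`.  (`W_{m₁} × … `-style products of reflection subgroups.) -/
def blkSub (n : ℕ) (f : Fin n → ℕ) (ty : Fin n → BTy) : Subgroup (PG n) :=
  Subgroup.closure
    ({π | ∃ i j, f i = f j ∧ π = dsw i j} ∪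
     {π | ∃ i, ty i = BTy.B ∧ π = ssw i} ∪
     {π | ∃ i j, f i = f j ∧ ty i = BTy.D ∧ ty j = BTy.D ∧ π = msw i j})

/-- The hyperoctahedral group `W_n` (Weyl group of type `B_n/C_n`). -/
def BWn (n : ℕ) : Subgroup (PG n) := blkSub n (fun _ => 0) (fun _ => BTy.B)

/-- The Weyl group `W'_n` of type `D_n` (the even elements of `W_n`). -/
def DWn (n : ℕ) : Subgroup (PG n) := blkSub n (fun _ => 0) (fun _ => BTy.D)

/-- The block of the index `i`, for blocks of consecutive sizes `c 0, c 1, …`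
(`N` blocks in total). -/
def blockOf (N : ℕ) (c : ℕ → ℕ) (i : ℕ) : ℕ :=
  ((Finset.range N).filter fun b => ∑ b' ∈ Finset.range (b + 1), c b' ≤ i).card

/-- The linear character of (a reflection subgroup of) `W_n` given by the product of
the signs of the coordinates in `T`. -/
def epsOn {n : ℕ} (T : Set (Fin n)) : PG n → ℂ :=
  open scoped Classical in
  fun π => ∏ᶠ i : Fin n, if i ∈ T ∧ (∃ j, π (Sum.inl i) = Sum.inr j) then -1 else 1

/-- The basic induced character of `W_n` attached to two sequences of (possibly
negative, in which case the character is `0`) block sizes: the character induced from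
the product of the hyperoctahedral groups of the blocks, of the (trivial) ⊠ (product
of signs of coordinates) character, the second family of blocks carrying the
sign-of-coordinates character.  (These are the `h`-pieces of the Jacobi–Trudi-type
formula for the irreducible characters of `W_n`.) -/
def indPiece (n r s : ℕ) (c : Fin r → ℤ) (d : Fin s → ℤ) : (BWn n) → ℂ :=
  open scoped Classical in
  if (∀ i, 0 ≤ c i) ∧ (∀ j, 0 ≤ d j) ∧ ((∑ i, c i) + ∑ j, d j) = (n : ℤ) then
    letI cs : ℕ → ℕ := fun b =>
      if hb : b < r then (c ⟨b, hb⟩).toNat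
      else if hb' : b - r < s then (d ⟨b - r, hb'⟩).toNat else 0
    letI f : Fin n → ℕ := fun i => blockOf (r + s) cs (i : ℕ)
    indChar (blkSub n f (fun _ => BTy.B)) (BWn n)
      (resChar _ (epsOn {i | r ≤ f i}))
  else 0

/-- The irreducible character of the hyperoctahedral group `W_n` attached to a
bipartition `(α, β)` (each written as a weakly decreasing integer vector), via the
Jacobi–Trudi-type determinantal formula
`χ_{(α,β)} = ∑_{σ,τ} sgn(σ)sgn(τ) · indPiece((αᵢ - i + σ(i))ᵢ, (βⱼ - j + τ(j))ⱼ)`. -/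
def chiB (n r s : ℕ) (α : Fin r → ℤ) (β : Fin s → ℤ) : (BWn n) → ℂ :=
  fun w => ∑ᶠ σ : Equiv.Perm (Fin r), ∑ᶠ τ : Equiv.Perm (Fin s),
    (((Equiv.Perm.sign σ : ℤ) * (Equiv.Perm.sign τ : ℤ) : ℤ) : ℂ) *
      indPiece n r s (fun i => α i - (i : ℕ) + ((σ i : ℕ) : ℤ))
        (fun j => β j - (j : ℕ) + ((τ j : ℕ) : ℤ)) w

/-- The irreducible character of `W_n` attached to a symbol
`[(λ₀ < … < λ_m), (μ₀ < … < μ_{m-1})]` (rows written as increasing sequences, with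
`∑λ + ∑μ = m² + n`): subtract the staircases to get the bipartition. -/
def chiBSymbol (n m : ℕ) (row1 : Fin (m + 1) → ℕ) (row2 : Fin m → ℕ) : (BWn n) → ℂ :=
  chiB n (m + 1) m
    (fun i => (row1 ⟨m - (i : ℕ), by have := i.isLt; omega⟩ : ℤ) - ((m - (i : ℕ) : ℕ) : ℤ))
    (fun j => (row2 ⟨m - 1 - (j : ℕ), by have := j.isLt; omega⟩ : ℤ) -
      ((m - 1 - (j : ℕ) : ℕ) : ℤ))

/-- The irreducible character of `W'_n` (type `D_n`) attached to a symbol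
`[(λ₀ < … < λ_{m-1}), (μ₀ < … < μ_{m-1})]` with distinct rows (`∑λ + ∑μ = m² - m + n`):
the restriction to `W'_n` of the corresponding character of `W_n`. -/
def chiDSymbol (n m : ℕ) (row1 row2 : Fin m → ℕ) : (DWn n) → ℂ :=
  resSub (DWn n) (BWn n)
    (chiB n m m
      (fun i => (row1 ⟨m - 1 - (i : ℕ), by have := i.isLt; omega⟩ : ℤ) -
        ((m - 1 - (i : ℕ) : ℕ) : ℤ))
      (fun j => (row2 ⟨m - 1 - (j : ℕ), by have := j.isLt; omega⟩ : ℤ) -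
        ((m - 1 - (j : ℕ) : ℕ) : ℤ)))

/-- An action of `G` on a set `X` together with a multiplicative cocycle: the data of a
monomial representation on the span of `X`. -/
structure SAct (G X : Type) [Group G] where
  /-- the action -/
  act : G → X → X
  /-- the cocycle -/
  wt : G → X → ℂ
  act_one : ∀ x, act 1 x = x
  wt_one : ∀ x, wt 1 x = 1
  act_mul : ∀ g h x, act (g * h) x = act g (act h x)
  wt_mul : ∀ g h x, wt (g * h) x = wt g (act h x) * wt h x

namespace SAct

variable {G G' X Y : Type} [Group G] [Group G']

theorem act_inv_eq_iff (A : SAct G X) (g : G) (x y : X) :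
    A.act g⁻¹ x = y ↔ x = A.act g y := by
  constructor
  · rintro rfl; rw [← A.act_mul, mul_inv_cancel, A.act_one]
  · rintro rfl; rw [← A.act_mul, inv_mul_cancel, A.act_one]

variable [DecidableEq X] [DecidableEq Y]

/-- The character of the monomial representation on the span of a finite subset. -/
def ch (A : SAct G X) (S : Finset X) (g : G) : ℂ :=
  ∑ x ∈ S, if A.act g x = x then A.wt g x else 0

/-- The tensor product of two monomial representations. -/
def prod (A : SAct G X) (B : SAct G Y) : SAct G (X × Y) where
  act g x := (A.act g x.1, B.act g x.2)
  wt g x := A.wt g x.1 * B.wt g x.2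
  act_one x := by simp [A.act_one, B.act_one]
  wt_one x := by simp [A.wt_one, B.wt_one]
  act_mul g h x := by simp [A.act_mul, B.act_mul]
  wt_mul g h x := by simp only [A.wt_mul, B.wt_mul]; ring

/-- The twist of a monomial representation by a linear character. -/
def twist (A : SAct G X) (θ : G →* ℂ) : SAct G X where
  act := A.act
  wt g x := θ g * A.wt g x
  act_one := A.act_one
  wt_one x := by simp [A.wt_one]
  act_mul := A.act_mul
  wt_mul g h x := by simp only [A.wt_mul, map_mul]; ring

/-- The pull-back of a monomial representation along a group homomorphism. -/
def comap (A : SAct G X) (f : G' →* G) : SAct G' X where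
  act g := A.act (f g)
  wt g := A.wt (f g)
  act_one x := by simp [A.act_one]
  wt_one x := by simp [A.wt_one]
  act_mul g h x := by simp [A.act_mul]
  wt_mul g h x := by simp [A.wt_mul]

theorem ch_prod (A : SAct G X) (B : SAct G Y) (S : Finset X) (T : Finset Y) (g : G) :
    (A.prod B).ch (S ×ˢ T) g = A.ch S g * B.ch T g := by
  simp only [ch, prod, Finset.sum_product, Finset.sum_mul_sum, Prod.ext_iff]
  refine Finset.sum_congr rfl fun x _ => Finset.sum_congr rfl fun y _ => ?_
  split_ifs <;> simp_all

theorem ch_twist (A : SAct G X) (θ : G →* ℂ) (S : Finset X) (g : G) :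
    (A.twist θ).ch S g = θ g * A.ch S g := by
  rw [ch, ch, Finset.mul_sum]
  refine Finset.sum_congr rfl fun x _ => ?_
  rw [mul_ite, mul_zero]
  rfl

theorem ch_comap (A : SAct G X) (f : G' →* G) (S : Finset X) (g : G') :
    (A.comap f).ch S g = A.ch S (f g) := rfl

theorem ch_inv (A : SAct G X) (hA : ∀ g x, A.wt g x * A.wt g x = 1) (S : Finset X) (g : G) :
    A.ch S g⁻¹ = A.ch S g := by
  refine Finset.sum_congr rfl fun x _ => ?_
  by_cases h : A.act g x = x
  · have h' : A.act g⁻¹ x = x := (A.act_inv_eq_iff g x x).2 h.symm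
    rw [if_pos h, if_pos h']
    have h1 := A.wt_mul g⁻¹ g x
    rw [inv_mul_cancel, A.wt_one, h] at h1
    have h2 := hA g x
    linear_combination (-A.wt g⁻¹ x) * h2 - A.wt g x * h1
  · have h' : ¬ A.act g⁻¹ x = x := fun h' => h ((A.act_inv_eq_iff g x x).1 h').symm
    rw [if_neg h, if_neg h']

theorem isChar_ch (A : SAct G X) (S : Finset X) (hS : ∀ g, ∀ x ∈ S, A.act g x ∈ S) :
    IsChar (A.ch S) := by
  let M : G →* Matrix S S ℂ :=
    { toFun := fun g => Matrix.of fun y x => if A.act g x = y then A.wt g x else 0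
      map_one' := by
        ext y x
        simp only [A.act_one, A.wt_one, Matrix.of_apply, Matrix.one_apply, Subtype.ext_iff, eq_comm]
      map_mul' := fun g h => by
        ext y x
        simp only [Matrix.of_apply, Matrix.mul_apply, A.act_mul, A.wt_mul]
        rw [Finset.sum_eq_single (⟨A.act h x, hS h x x.2⟩ : S)]
        · simp
        · intro z _ hz
          rw [if_neg (c := A.act h x = z) (fun h' => hz (Subtype.ext h'.symm)), mul_zero]
        · simp }
  refine ⟨S → ℂ, inferInstance, inferInstance,
    ((Matrix.toLinAlgEquiv' : Matrix S S ℂ ≃ₐ[ℂ] _) : Matrix S S ℂ →* _).comp M,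
    inferInstance, fun g => ?_⟩
  have : LinearMap.trace ℂ (S → ℂ) (Matrix.toLin' (M g)) = (M g).trace := Matrix.trace_toLin'_eq _
  refine Eq.trans ?_ this.symm
  simp only [ch, Matrix.trace, M, MonoidHom.coe_mk, OneHom.coe_mk, Matrix.diag, Matrix.of_apply]
  rw [← Finset.sum_coe_sort]

end SAct

theorem IsChar.conj {G : Type} [Group G] {χ : G → ℂ} (h : IsChar χ) (x g : G) :
    χ (x⁻¹ * g * x) = χ g := by
  obtain ⟨V, _, _, ρ, _, hρ⟩ := h
  rw [hρ, hρ, mul_assoc, map_mul, LinearMap.trace_mul_comm, ← map_mul, mul_assoc, mul_inv_cancel,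
    mul_one]

/-- The average of a function over a finite group. -/
def avg {G : Type} [Group G] (φ : G → ℂ) : ℂ := (Nat.card G : ℂ)⁻¹ * ∑ᶠ g : G, φ g

namespace SAct

variable {G X : Type} [Group G] [Fintype G] [DecidableEq X]

theorem sum_stab_eq_zero (A : SAct G X) (x : X) (h : G) (hx : A.act h x = x)
    (hw : A.wt h x ≠ 1) : ∑ g : G, (if A.act g x = x then A.wt g x else 0) = 0 := by
  have key : ∑ g : G, (if A.act g x = x then A.wt g x else 0) =
      (∑ g : G, (if A.act g x = x then A.wt g x else 0)) * A.wt h x := by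
    conv_lhs => rw [← Equiv.sum_comp (Equiv.mulRight h)]
    rw [Finset.sum_mul]
    refine Finset.sum_congr rfl fun g _ => ?_
    simp only [Equiv.coe_mulRight, A.act_mul, A.wt_mul, hx]
    split_ifs <;> simp
  have : (∑ g : G, (if A.act g x = x then A.wt g x else 0)) * (A.wt h x - 1) = 0 := by
    rw [mul_sub, ← key]; ring
  exact (mul_eq_zero.1 this).resolve_right (sub_ne_zero.2 hw)

theorem sum_stab_eq_card (A : SAct G X) (x : X) (hw : ∀ g, A.act g x = x → A.wt g x = 1) :
    ∑ g : G, (if A.act g x = x then A.wt g x else 0) =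
      ((univ.filter fun g => A.act g x = x).card : ℂ) := by
  rw [Finset.card_filter]
  push_cast
  exact Finset.sum_congr rfl fun g _ => by split_ifs with h <;> simp [*]

theorem avg_ch (A : SAct G X) (S : Finset X) :
    avg (A.ch S) = (Nat.card G : ℂ)⁻¹ *
      ∑ x ∈ S, ∑ g : G, (if A.act g x = x then A.wt g x else 0) := by
  rw [avg, finsum_eq_sum_of_fintype, Finset.sum_comm]
  rfl

theorem avg_ch_eq_zero (A : SAct G X) (S : Finset X)
    (h : ∀ x ∈ S, ∃ g, A.act g x = x ∧ A.wt g x ≠ 1) : avg (A.ch S) = 0 := by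
  rw [avg_ch, Finset.sum_eq_zero, mul_zero]
  intro x hx
  obtain ⟨g, h1, h2⟩ := h x hx
  exact A.sum_stab_eq_zero x g h1 h2

theorem avg_ch_ne_zero (A : SAct G X) (S : Finset X) (x₀ : X) (hx₀ : x₀ ∈ S)
    (h : ∀ g, A.act g x₀ = x₀ → A.wt g x₀ = 1) : avg (A.ch S) ≠ 0 := by
  classical
  rw [avg_ch]
  refine mul_ne_zero (inv_ne_zero (Nat.cast_ne_zero.2 Nat.card_pos.ne')) ?_
  have key : ∀ x, ∑ g : G, (if A.act g x = x then A.wt g x else 0) =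
      ((if ∀ g, A.act g x = x → A.wt g x = 1 then
        (univ.filter fun g => A.act g x = x).card else 0 : ℕ) : ℂ) := by
    intro x
    split_ifs with hx
    · exact A.sum_stab_eq_card x hx
    · push Not at hx
      obtain ⟨g, h1, h2⟩ := hx
      simpa using A.sum_stab_eq_zero x g h1 h2
  simp only [key]
  rw [← Nat.cast_sum, Nat.cast_ne_zero]
  refine (Finset.sum_pos' (fun _ _ => Nat.zero_le _) ⟨x₀, hx₀, ?_⟩).ne'
  rw [if_pos h]
  exact Finset.card_pos.2 ⟨1, by simp [A.act_one]⟩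

theorem avg_ch_eq_one (A : SAct G X) (S : Finset X) (x₀ : X) (hx₀ : ∀ g, A.act g x₀ ∈ S)
    (h : ∀ g, A.act g x₀ = x₀ → A.wt g x₀ = 1)
    (hS : ∀ x ∈ S, (∃ g, A.act g x = x ∧ A.wt g x ≠ 1) ∨ ∃ g, A.act g x₀ = x) :
    avg (A.ch S) = 1 := by
  classical
  rw [avg_ch]
  have key : ∀ x ∈ S, ∑ g : G, (if A.act g x = x then A.wt g x else 0) =
      ((univ.filter fun g => A.act g x₀ = x).card : ℂ) := by
    intro x hx
    by_cases ho : ∃ g, A.act g x₀ = x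
    · obtain ⟨k, rfl⟩ := ho
      rw [A.sum_stab_eq_card]
      · congr 1
        refine Finset.card_bij' (fun g _ => g * k) (fun g _ => g * k⁻¹) ?_ ?_ ?_ ?_
        · intro g; simp [A.act_mul]
        · intro g
          simp only [mem_filter, mem_univ, true_and]
          intro hg
          rw [A.act_mul, (A.act_inv_eq_iff k _ x₀).2 rfl, hg]
        · intro g _; simp
        · intro g _; simp
      · intro g hg
        have h1 : A.act (k⁻¹ * (g * k)) x₀ = x₀ := by
          rw [A.act_mul, A.act_mul, hg, A.act_inv_eq_iff]
        have h2 := h _ h1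
        have h3 := A.wt_mul k⁻¹ k x₀
        rw [inv_mul_cancel, A.wt_one] at h3
        rw [A.wt_mul, A.wt_mul, A.act_mul, hg] at h2
        linear_combination h2 + A.wt g (A.act k x₀) * h3
    · obtain ⟨g, h1, h2⟩ := (hS x hx).resolve_right ho
      rw [A.sum_stab_eq_zero x g h1 h2]
      push Not at ho
      simp [ho]
  rw [Finset.sum_congr rfl key, ← Nat.cast_sum,
    ← Finset.card_eq_sum_card_fiberwise (f := fun g => A.act g x₀) (fun g _ => by simpa using hx₀ g),
    Finset.card_univ, Nat.card_eq_fintype_card]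
  exact inv_mul_cancel₀ (Nat.cast_ne_zero.2 Fintype.card_ne_zero)

end SAct

theorem cinner_eq_avg {G : Type} [Group G] (φ ψ χ : G → ℂ) (h : ∀ g, φ g * ψ g⁻¹ = χ g) :
    cinner φ ψ = avg χ := by
  rw [cinner, avg, finsum_congr h]

/-- Frobenius reciprocity. -/
theorem cinner_indChar {G : Type} [Group G] [Finite G] (H K : Subgroup G) (hHK : H ≤ K)
    (χ : K → ℂ) (φ : H → ℂ) (hχ : IsChar χ) :
    cinner χ (indChar H K φ) = avg fun h : H => χ (Subgroup.inclusion hHK h)⁻¹ * φ h := by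
  classical
  have := Fintype.ofFinite G
  have hK : (Nat.card K : ℂ) ≠ 0 := Nat.cast_ne_zero.2 Nat.card_pos.ne'
  simp only [cinner, indChar, avg, finsum_eq_sum_of_fintype, Finset.mul_sum]
  rw [Finset.sum_comm]
  have key : ∀ x : K, ∑ g : K, (Nat.card K : ℂ)⁻¹ * (χ g * ((Nat.card H : ℂ)⁻¹ *
      if h : ((x : G) * (g⁻¹ : K) * (x : G)⁻¹) ∈ H then φ ⟨_, h⟩ else 0)) =
      (Nat.card K : ℂ)⁻¹ * ∑ h : H, (Nat.card H : ℂ)⁻¹ *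
        (χ (Subgroup.inclusion hHK h)⁻¹ * φ h) := by
    intro x
    rw [Finset.mul_sum]
    symm
    rw [← Finset.sum_filter_of_ne (p := fun g : K => ((x : G) * (g⁻¹ : K) * (x : G)⁻¹) ∈ H)]
    · refine Finset.sum_bij' (fun h _ => x⁻¹ * (Subgroup.inclusion hHK h)⁻¹ * x)
        (fun g hg => ⟨(x : G) * (g⁻¹ : K) * (x : G)⁻¹, (mem_filter.1 hg).2⟩) ?_ ?_ ?_ ?_ ?_
      · intro h _
        simp [mul_assoc]
      · simp
      · intro h _
        ext1
        simp [mul_assoc]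
      · intro g hg
        ext1
        simp [mul_assoc]
      · intro h _
        rw [hχ.conj]
        have e : (x : G) * ((x⁻¹ * (Subgroup.inclusion hHK h)⁻¹ * x : K)⁻¹ : K) * (x : G)⁻¹ = h := by
          simp [mul_assoc]
        rw [dif_pos (by rw [e]; exact h.2)]
        simp only [e]
        ring
    · intro g _ hg
      by_contra hn
      rw [dif_neg hn] at hg
      simp at hg
  rw [Finset.sum_congr rfl fun x _ => key x, Finset.sum_const, Finset.card_univ, nsmul_eq_mul,
    ← Nat.card_eq_fintype_card, ← mul_assoc, mul_inv_cancel₀ hK, one_mul]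

section SignedPermutations

theorem apply_inv_apply {α : Type*} (p : Perm α) (x : α) : p (p⁻¹ x) = x := p.apply_symm_apply x

theorem inv_apply_apply {α : Type*} (p : Perm α) (x : α) : p⁻¹ (p x) = x := p.symm_apply_apply x

variable {n : ℕ}

/-- The subgroup of all signed permutations: those commuting with the exchange of signs. -/
def signedPerms (n : ℕ) : Subgroup (PG n) where
  carrier := {π | ∀ x, π x.swap = (π x).swap}
  one_mem' := fun _ => rfl
  mul_mem' := fun {a b} ha hb x => by
    rw [Perm.mul_apply, Perm.mul_apply, hb, ha]
  inv_mem' := fun {a} ha x => by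
    rw [Perm.inv_eq_iff_eq, ha, apply_inv_apply]

/-- The unsigned permutation `e_i ↦ e_{p i}`. -/
def liftPerm (p : Perm (Fin n)) : PG n := Equiv.sumCongr p p

theorem liftPerm_inl (p : Perm (Fin n)) (i : Fin n) : liftPerm p (Sum.inl i) = Sum.inl (p i) := rfl

theorem liftPerm_inr (p : Perm (Fin n)) (i : Fin n) : liftPerm p (Sum.inr i) = Sum.inr (p i) := rfl

theorem liftPerm_mul (p q : Perm (Fin n)) : liftPerm (p * q) = liftPerm p * liftPerm q := by
  ext x; rcases x with x | x <;> rfl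

theorem dsw_eq_liftPerm (i j : Fin n) : dsw i j = liftPerm (swap i j) := by
  ext x
  rcases x with x | x <;>
    simp only [dsw, Perm.mul_apply, swap_apply_def, liftPerm_inl, liftPerm_inr] <;>
    split_ifs <;> simp_all

theorem ssw_inl (i k : Fin n) :
    ssw i (Sum.inl k) = if k = i then Sum.inr k else Sum.inl k := by
  simp only [ssw, swap_apply_def]
  split_ifs <;> simp_all

theorem ssw_inr (i k : Fin n) :
    ssw i (Sum.inr k) = if k = i then Sum.inl k else Sum.inr k := by
  simp only [ssw, swap_apply_def]
  split_ifs <;> simp_all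

theorem msw_eq (i j : Fin n) (hij : i ≠ j) : msw i j = dsw i j * (ssw i * ssw j) := by
  have hji := hij.symm
  ext x
  rw [dsw_eq_liftPerm]
  rcases x with x | x <;>
  by_cases h1 : x = i <;> by_cases h2 : x = j <;>
    simp_all [msw, Perm.mul_apply, ssw_inl, ssw_inr, liftPerm_inl, liftPerm_inr, swap_apply_def]

theorem liftPerm_mem_signedPerms (p : Perm (Fin n)) : liftPerm p ∈ signedPerms n := by
  rintro (x | x) <;> rfl

theorem ssw_mem_signedPerms (i : Fin n) : ssw i ∈ signedPerms n := by
  rintro (x | x) <;> simp only [Sum.swap_inl, Sum.swap_inr, ssw_inl, ssw_inr] <;>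
    split_ifs <;> rfl

theorem msw_self (i : Fin n) : msw i i = 1 := by
  rw [msw, swap_comm (Sum.inr i), swap_mul_self]

theorem msw_mem_signedPerms (i j : Fin n) : msw i j ∈ signedPerms n := by
  by_cases hij : i = j
  · subst hij
    rw [msw_self]
    exact one_mem _
  · rw [msw_eq i j hij, dsw_eq_liftPerm]
    exact mul_mem (liftPerm_mem_signedPerms _)
      (mul_mem (ssw_mem_signedPerms _) (ssw_mem_signedPerms _))

theorem blkSub_le_signedPerms (f : Fin n → ℕ) (ty : Fin n → BTy) :
    blkSub n f ty ≤ signedPerms n := by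
  rw [blkSub, Subgroup.closure_le]
  rintro π ((⟨i, j, _, rfl⟩ | ⟨i, _, rfl⟩) | ⟨i, j, _, _, _, rfl⟩)
  · rw [dsw_eq_liftPerm]; exact liftPerm_mem_signedPerms _
  · exact ssw_mem_signedPerms _
  · exact msw_mem_signedPerms _ _

theorem dsw_mem_blkSub {f : Fin n → ℕ} {ty : Fin n → BTy} {i j : Fin n} (h : f i = f j) :
    dsw i j ∈ blkSub n f ty :=
  Subgroup.subset_closure (Or.inl (Or.inl ⟨i, j, h, rfl⟩))

theorem ssw_mem_blkSub {f : Fin n → ℕ} {ty : Fin n → BTy} {i : Fin n} (h : ty i = BTy.B) :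
    ssw i ∈ blkSub n f ty :=
  Subgroup.subset_closure (Or.inl (Or.inr ⟨i, h, rfl⟩))

theorem msw_mem_blkSub {f : Fin n → ℕ} {ty : Fin n → BTy} {i j : Fin n} (h : f i = f j)
    (hi : ty i = BTy.D) (hj : ty j = BTy.D) : msw i j ∈ blkSub n f ty :=
  Subgroup.subset_closure (Or.inr ⟨i, j, h, hi, hj, rfl⟩)

/-- Unsigned permutations preserving the blocks belong to the block subgroup, whatever the
types of the blocks. -/
theorem liftPerm_mem_blkSub (f : Fin n → ℕ) (ty : Fin n → BTy) (p : Perm (Fin n))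
    (hp : ∀ i, f (p i) = f i) : liftPerm p ∈ blkSub n f ty := by
  induction hk : p.support.card using Nat.strong_induction_on generalizing p with
  | _ k ih =>
    subst hk
    by_cases h1 : p = 1
    · subst h1
      have : liftPerm (1 : Perm (Fin n)) = 1 := by ext x; rcases x with x | x <;> rfl
      rw [this]
      exact one_mem _
    · obtain ⟨i, hi⟩ : ∃ i, p i ≠ i := by
        by_contra! h
        exact h1 (Perm.ext h)
      have hlt := Perm.card_support_swap_mul hi
      have := ih _ hlt (swap i (p i) * p) (fun j => by
        rw [Perm.mul_apply, swap_apply_def]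
        split_ifs with ha hb
        · rw [hp, ← hp j, ha]
        · rw [← hp i, ← hb, hp]
        · exact hp j) rfl
      have e : liftPerm p = dsw i (p i) * liftPerm (swap i (p i) * p) := by
        rw [dsw_eq_liftPerm, ← liftPerm_mul, swap_mul_self_mul]
      rw [e]
      exact mul_mem (dsw_mem_blkSub (hp i).symm) this

theorem mem_BWn_of_mem_blkSub {f : Fin n → ℕ} {ty : Fin n → BTy} {π : PG n}
    (h : π ∈ blkSub n f ty) : π ∈ BWn n := by
  refine (?_ : blkSub n f ty ≤ BWn n) h
  rw [blkSub, Subgroup.closure_le]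
  rintro π ((⟨i, j, _, rfl⟩ | ⟨i, _, rfl⟩) | ⟨i, j, _, _, _, rfl⟩)
  · exact dsw_mem_blkSub rfl
  · exact ssw_mem_blkSub rfl
  · by_cases hij : i = j
    · subst hij
      rw [msw_self]
      exact one_mem _
    · rw [msw_eq i j hij]
      exact mul_mem (dsw_mem_blkSub rfl) (mul_mem (ssw_mem_blkSub rfl) (ssw_mem_blkSub rfl))

theorem signed_of_mem_BWn (g : BWn n) (x : Fin n ⊕ Fin n) :
    (g : PG n) x.swap = ((g : PG n) x).swap :=
  blkSub_le_signedPerms _ _ g.2 x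

/-- The underlying unsigned index of a point. -/
def absPt (x : Fin n ⊕ Fin n) : Fin n := Sum.elim id id x

theorem absPt_swap (x : Fin n ⊕ Fin n) : absPt x.swap = absPt x := by
  rcases x with x | x <;> rfl

theorem absPt_apply (g : BWn n) (x : Fin n ⊕ Fin n) :
    absPt ((g : PG n) x) = absPt ((g : PG n) (Sum.inl (absPt x))) := by
  rcases x with x | x
  · rfl
  · rw [← absPt_swap, ← signed_of_mem_BWn]
    rfl

/-- The permutation of the coordinates underlying a signed permutation. -/
def basePerm : BWn n →* Perm (Fin n) :=
  MonoidHom.toHomPerm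
    { toFun := fun g i => absPt ((g : PG n) (Sum.inl i))
      map_one' := rfl
      map_mul' := fun g h => by
        funext i
        exact absPt_apply g ((h : PG n) (Sum.inl i)) }

theorem basePerm_apply (g : BWn n) (i : Fin n) :
    basePerm g i = absPt ((g : PG n) (Sum.inl i)) := rfl

/-- The sign with which a signed permutation moves the `i`-th coordinate. -/
def coordSign (g : BWn n) (i : Fin n) : ℂ := if ((g : PG n) (Sum.inl i)).isLeft then 1 else -1

theorem coordSign_mul_self (g : BWn n) (i : Fin n) : coordSign g i * coordSign g i = 1 := by
  rw [coordSign]; split_ifs <;> norm_num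

theorem apply_inl (g : BWn n) (i : Fin n) :
    ((g : PG n) (Sum.inl i) = Sum.inl (basePerm g i) ∧ coordSign g i = 1) ∨
      ((g : PG n) (Sum.inl i) = Sum.inr (basePerm g i) ∧ coordSign g i = -1) := by
  rw [basePerm_apply, coordSign]
  rcases h : (g : PG n) (Sum.inl i) with x | x
  · left; simp [absPt]
  · right; simp [absPt]

theorem apply_inr (g : BWn n) (i : Fin n) :
    (g : PG n) (Sum.inr i) = ((g : PG n) (Sum.inl i)).swap :=
  signed_of_mem_BWn g (Sum.inl i)

theorem coordSign_one (i : Fin n) : coordSign (1 : BWn n) i = 1 := rfl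

theorem coordSign_mul (g h : BWn n) (i : Fin n) :
    coordSign (g * h) i = coordSign g (basePerm h i) * coordSign h i := by
  have e : ((g * h : BWn n) : PG n) (Sum.inl i) = (g : PG n) ((h : PG n) (Sum.inl i)) := rfl
  rw [coordSign, e]
  rcases apply_inl h i with ⟨h1, h2⟩ | ⟨h1, h2⟩
  · rw [h1, h2, mul_one]; rfl
  · rw [h1, h2, apply_inr, coordSign]
    rcases (g : PG n) (Sum.inl (basePerm h i)) with x | x <;> simp

theorem ext_BWn {g h : BWn n} (hp : basePerm g = basePerm h)
    (hs : ∀ i, coordSign g i = coordSign h i) : g = h := by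
  have key : ∀ i, (g : PG n) (Sum.inl i) = (h : PG n) (Sum.inl i) := by
    intro i
    have := hs i
    rcases apply_inl g i with ⟨h1, h2⟩ | ⟨h1, h2⟩ <;>
    rcases apply_inl h i with ⟨h3, h4⟩ | ⟨h3, h4⟩ <;> rw [h1, h3, hp] <;>
    rw [h2, h4] at this <;> norm_num at this
  ext1
  refine Perm.ext fun x => ?_
  rcases x with x | x
  · exact key x
  · rw [apply_inr, apply_inr, key]

/-- Unsigned permutations as elements of the hyperoctahedral group. -/
def permB (p : Perm (Fin n)) : BWn n := ⟨liftPerm p, liftPerm_mem_blkSub _ _ p fun _ => rfl⟩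

/-- Sign changes as elements of the hyperoctahedral group. -/
def flipB (i : Fin n) : BWn n := ⟨ssw i, ssw_mem_blkSub rfl⟩

@[simp] theorem basePerm_permB (p : Perm (Fin n)) : basePerm (permB p) = p := rfl

@[simp] theorem coordSign_permB (p : Perm (Fin n)) (i : Fin n) : coordSign (permB p) i = 1 := rfl

@[simp] theorem basePerm_flipB (i : Fin n) : basePerm (flipB i) = 1 := by
  refine Perm.ext fun k => ?_
  rw [basePerm_apply, flipB, ssw_inl]
  split_ifs <;> rfl

theorem coordSign_flipB (i k : Fin n) : coordSign (flipB i) k = if k = i then -1 else 1 := by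
  rw [coordSign, flipB, ssw_inl]
  split_ifs <;> simp_all

theorem mem_blkSub_B_of (f : Fin n → ℕ) (g : BWn n) (hg : ∀ i, f (basePerm g i) = f i) :
    (g : PG n) ∈ blkSub n f (fun _ => BTy.B) := by
  induction hk : (univ.filter fun i => coordSign g i = -1).card using Nat.strong_induction_on
    generalizing g with
  | _ k ih =>
    subst hk
    by_cases h1 : ∃ i, coordSign g i = -1
    · obtain ⟨i, hi⟩ := h1
      have hlt : (univ.filter fun j => coordSign (g * flipB i) j = -1).card <
          (univ.filter fun j => coordSign g j = -1).card := by
        refine Finset.card_lt_card ⟨fun j => ?_, fun h => ?_⟩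
        · simp only [mem_filter, mem_univ, true_and, coordSign_mul, basePerm_flipB, Perm.one_apply,
            coordSign_flipB]
          split_ifs with hj
          · subst hj; rw [hi]; norm_num
          · simp
        · have := h (mem_filter.2 ⟨mem_univ i, hi⟩)
          simp only [mem_filter, mem_univ, true_and, coordSign_mul, basePerm_flipB, Perm.one_apply,
            coordSign_flipB, hi, if_true] at this
          norm_num at this
      have := ih _ hlt (g * flipB i) (fun j => by simpa using hg j) rfl
      have h2 := mul_mem this (inv_mem (ssw_mem_blkSub (f := f) (ty := fun _ => BTy.B) (i := i) rfl))
      simpa [flipB] using h2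
    · have : g = permB (basePerm g) := ext_BWn rfl fun i => by
        rcases apply_inl g i with ⟨_, h⟩ | ⟨_, h⟩
        · rw [h, coordSign_permB]
        · exact absurd ⟨i, h⟩ h1
      rw [this]
      exact liftPerm_mem_blkSub _ _ _ hg

/-- The elements of `W_n` preserving the blocks of `f`. -/
def blockStab (f : Fin n → ℕ) : Subgroup (BWn n) where
  carrier := {g | ∀ i, f (basePerm g i) = f i}
  one_mem' := fun _ => rfl
  mul_mem' := fun {a b} ha hb i => by rw [map_mul, Perm.mul_apply, ha, hb]
  inv_mem' := fun {a} ha i => by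
    have := ha ((basePerm a⁻¹) i)
    rw [← this, map_inv, apply_inv_apply]

theorem blkSub_le_map_of_gen (f : Fin n → ℕ) (ty : Fin n → BTy) (K : Subgroup (BWn n))
    (h1 : ∀ i j, f i = f j → permB (swap i j) ∈ K) (h2 : ∀ i, ty i = BTy.B → flipB i ∈ K)
    (h3 : ∀ i j, i ≠ j → f i = f j → ty i = BTy.D → ty j = BTy.D → flipB i * flipB j ∈ K) :
    blkSub n f ty ≤ K.map (BWn n).subtype := by
  rw [blkSub, Subgroup.closure_le]
  rintro π ((⟨i, j, hf, rfl⟩ | ⟨i, hi, rfl⟩) | ⟨i, j, hf, hi, hj, rfl⟩)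
  · exact ⟨_, h1 i j hf, (dsw_eq_liftPerm i j).symm⟩
  · exact ⟨_, h2 i hi, rfl⟩
  · by_cases hij : i = j
    · subst hij
      rw [msw_self]
      exact one_mem _
    · rw [msw_eq i j hij]
      exact ⟨_, mul_mem (h1 i j hf) (h3 i j hij hf hi hj), by rw [dsw_eq_liftPerm]; rfl⟩

theorem mem_of_mem_blkSub {f : Fin n → ℕ} {ty : Fin n → BTy} {K : Subgroup (BWn n)}
    (h : blkSub n f ty ≤ K.map (BWn n).subtype) (g : BWn n) (hg : (g : PG n) ∈ blkSub n f ty) :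
    g ∈ K := by
  obtain ⟨k, hk, e⟩ := h hg
  have : k = g := Subtype.ext e
  exact this ▸ hk

theorem mem_blkSub_B_iff (f : Fin n → ℕ) (g : BWn n) :
    (g : PG n) ∈ blkSub n f (fun _ => BTy.B) ↔ ∀ i, f (basePerm g i) = f i := by
  refine ⟨fun h => ?_, mem_blkSub_B_of f g⟩
  refine mem_of_mem_blkSub (K := blockStab f) (blkSub_le_map_of_gen _ _ _ ?_ ?_ ?_) g h
  · intro i j hij k
    rw [basePerm_permB, swap_apply_def]
    split_ifs with h1 h2 <;> simp_all
  · intro i _ k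
    simp
  · simp

/-- The unsigned elements of `W_n`. -/
def unsignedSub (n : ℕ) : Subgroup (BWn n) where
  carrier := {g | ∀ i, coordSign g i = 1}
  one_mem' := fun _ => rfl
  mul_mem' := fun {a b} ha hb i => by rw [coordSign_mul, ha, hb, one_mul]
  inv_mem' := fun {a} ha i => by
    have := coordSign_mul a a⁻¹ i
    rw [mul_inv_cancel, coordSign_one, ha, one_mul] at this
    exact this.symm

theorem coordSign_eq_one_of_mem_S (g : BWn n)
    (hg : (g : PG n) ∈ blkSub n (fun _ => 0) (fun _ => BTy.S)) (i : Fin n) : coordSign g i = 1 := by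
  refine (mem_of_mem_blkSub (K := unsignedSub n) (blkSub_le_map_of_gen _ _ _ ?_ ?_ ?_) g hg) i
  · intro i j _ k
    simp
  · simp
  · simp

/-- The elements of `W_n` preserving `A`, with an even number of sign changes on it. -/
def evenOnSub (A : Finset (Fin n)) : Subgroup (BWn n) where
  carrier := {g | (∀ i, basePerm g i ∈ A ↔ i ∈ A) ∧ ∏ i ∈ A, coordSign g i = 1}
  one_mem' := ⟨fun _ => Iff.rfl, by simp [coordSign_one]⟩
  mul_mem' := fun {a b} ha hb => by
    refine ⟨fun i => by rw [map_mul, Perm.mul_apply, ha.1, hb.1], ?_⟩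
    simp only [coordSign_mul, Finset.prod_mul_distrib]
    rw [hb.2, mul_one, ← ha.2]
    refine Finset.prod_bij (fun i _ => basePerm b i) (fun i hi => (hb.1 i).2 hi)
      (fun _ _ _ _ h => (basePerm b).injective h) (fun j hj => ?_) fun _ _ => rfl
    exact ⟨(basePerm b)⁻¹ j, (hb.1 _).1 (by simpa using hj), by simp⟩
  inv_mem' := fun {a} ha => by
    have h1 : ∀ i, basePerm a⁻¹ i ∈ A ↔ i ∈ A := fun i => by
      rw [← ha.1, map_inv, apply_inv_apply]
    refine ⟨h1, ?_⟩
    have : ∏ i ∈ A, coordSign (a * a⁻¹) i = 1 := by simp [coordSign_one]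
    simp only [coordSign_mul, Finset.prod_mul_distrib] at this
    rw [← this, eq_comm]
    refine mul_eq_right₀ ?_ |>.2 ?_
    · intro h
      rw [h, mul_zero] at this
      exact zero_ne_one this
    rw [← ha.2]
    refine Finset.prod_bij (fun i _ => basePerm a⁻¹ i) (fun i hi => (h1 i).2 hi)
      (fun _ _ _ _ h => (basePerm a⁻¹).injective h) (fun j hj => ?_) fun _ _ => rfl
    exact ⟨basePerm a j, (ha.1 _).2 hj, by simp⟩

theorem prod_coordSign_eq_one_of_mem (f : Fin n → ℕ) (ty : Fin n → BTy)
    (A : Finset (Fin n)) (hf : ∀ i j, f i = f j → (i ∈ A ↔ j ∈ A)) (hB : ∀ i ∈ A, ty i ≠ BTy.B)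
    (g : BWn n) (hg : (g : PG n) ∈ blkSub n f ty) : ∏ i ∈ A, coordSign g i = 1 := by
  refine (mem_of_mem_blkSub (K := evenOnSub A) (blkSub_le_map_of_gen _ _ _ ?_ ?_ ?_) g hg).2
  · intro i j hij
    refine ⟨fun k => ?_, by simp⟩
    have := hf i j hij
    rw [basePerm_permB, swap_apply_def]
    split_ifs with h1 h2 <;> simp_all
  · intro i hi
    refine ⟨by simp, ?_⟩
    have hiA : i ∉ A := fun h => hB i h hi
    simp [coordSign_flipB, Finset.prod_ite_eq', hiA]
  · intro i j hij hf' _ _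
    refine ⟨by simp, ?_⟩
    have := hf i j hf'
    simp only [coordSign_mul, coordSign_flipB, basePerm_flipB, Perm.one_apply,
      Finset.prod_mul_distrib, Finset.prod_ite_eq', this]
    split_ifs <;> norm_num

theorem reflChar_eq (g : BWn n) :
    reflChar (g : PG n) = ∑ i, if basePerm g i = i then coordSign g i else 0 := by
  rw [reflChar, Matrix.trace]
  refine Finset.sum_congr rfl fun i _ => ?_
  rw [Matrix.diag, Mrefl, Matrix.of_apply]
  rcases apply_inl g i with ⟨h1, h2⟩ | ⟨h1, h2⟩ <;> rw [h1, h2] <;> simp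
  split_ifs <;> simp

theorem sgnChar_eq (g : BWn n) :
    sgnChar (g : PG n) = (Perm.sign (basePerm g) : ℤ) * ∏ i, coordSign g i := by
  have : Mrefl (g : PG n) = Matrix.of fun j i =>
      coordSign g i * ((1 : Matrix (Fin n) (Fin n) ℂ).submatrix id (basePerm g)) j i := by
    ext j i
    rw [Mrefl, Matrix.of_apply, Matrix.of_apply, Matrix.submatrix_apply, Matrix.one_apply, id]
    rcases apply_inl g i with ⟨h1, h2⟩ | ⟨h1, h2⟩ <;> rw [h1, h2] <;> simp [eq_comm]
    split_ifs <;> simp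
  rw [sgnChar, this, Matrix.det_mul_row, Matrix.det_permute', Matrix.det_one, mul_one, mul_comm]

end SignedPermutations

section Newton

variable {n : ℕ} (p : Perm (Fin n))

/-- The number of visits to each point during the first `k` steps of the walk `i, p i, p² i, …`. -/
def visits (i : Fin n) (k : ℕ) (x : Fin n) : ℕ :=
  ∑ j ∈ Finset.range k, if p^[j] i = x then 1 else 0

theorem sum_visits (i : Fin n) (k : ℕ) : ∑ x, visits p i k x = k := by
  simp only [visits]
  rw [Finset.sum_comm]
  simp

theorem prod_pow_visits (s : Fin n → ℂ) (i : Fin n) (k : ℕ) :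
    ∏ x, s x ^ visits p i k x = ∏ j ∈ Finset.range k, s (p^[j] i) := by
  simp only [visits, ← Finset.prod_pow_eq_pow_sum]
  rw [Finset.prod_comm]
  refine Finset.prod_congr rfl fun j _ => ?_
  simp [Finset.prod_ite_eq, pow_ite]

theorem visits_apply (i : Fin n) (k : ℕ) (hk : p^[k] i = i) (x : Fin n) :
    visits p i k (p x) = visits p i k x := by
  have h1 : ∀ j, (if p^[j + 1] i = p x then 1 else 0) = if p^[j] i = x then 1 else 0 := by
    intro j
    rw [Function.iterate_succ_apply']
    simp
  have h2 := Finset.sum_range_succ (fun j => if p^[j] i = p x then 1 else 0) k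
  rw [Finset.sum_range_succ', Finset.sum_congr rfl fun j _ => h1 j, hk,
    Function.iterate_zero_apply] at h2
  exact (Nat.add_right_cancel h2).symm

theorem visits_add (i : Fin n) (a b : ℕ) (ha : p^[a] i = i) (x : Fin n) :
    visits p i (a + b) x = visits p i a x + visits p i b x := by
  rw [visits, Finset.sum_range_add, visits, visits]
  congr 1
  refine Finset.sum_congr rfl fun j _ => ?_
  rw [add_comm a j, Function.iterate_add_apply, ha]

theorem visits_minimalPeriod (i x : Fin n) :
    visits p i (Function.minimalPeriod p i) x ≤ 1 := by
  rw [visits, ← Finset.card_filter, Finset.card_le_one]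
  intro a ha b hb
  simp only [mem_filter, mem_range] at ha hb
  exact Function.iterate_injOn_Iio_minimalPeriod ha.1 hb.1 (ha.2.trans hb.2.symm)

theorem minimalPeriod_pos (i : Fin n) : 0 < Function.minimalPeriod p i :=
  Function.minimalPeriod_pos_of_mem_periodicPts
    (Function.Injective.mem_periodicPts p.injective i)

theorem visits_minimalPeriod_self (i : Fin n) :
    visits p i (Function.minimalPeriod p i) i = 1 := by
  refine le_antisymm (visits_minimalPeriod p i i) ?_
  rw [visits, ← Finset.card_filter]
  exact Finset.card_pos.2 ⟨0, by simpa using minimalPeriod_pos p i⟩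

theorem iterate_mul_minimalPeriod (i : Fin n) (q : ℕ) :
    p^[q * Function.minimalPeriod p i] i = i :=
  (Function.isPeriodicPt_minimalPeriod p i).const_mul q

theorem visits_mul (i x : Fin n) (q : ℕ) :
    visits p i (q * Function.minimalPeriod p i) x =
      q * visits p i (Function.minimalPeriod p i) x := by
  induction q with
  | zero => simp [visits]
  | succ q ih =>
    rw [add_mul, visits_add _ _ _ _ (iterate_mul_minimalPeriod p i q), ih]
    ring_nf

theorem apply_iterate_of_invariant {m : Fin n → ℕ} (hm : ∀ i, m (p i) = m i) (i : Fin n) (k : ℕ) :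
    m (p^[k] i) = m i := by
  induction k with
  | zero => rfl
  | succ k ih => rw [Function.iterate_succ_apply', hm, ih]

theorem card_closed_walks {m : Fin n → ℕ} (hm : ∀ i, m (p i) = m i) (i : Fin n) (d : ℕ)
    (hd : ∑ x, m x = d) :
    ((Finset.range d).filter fun k => p^[k + 1] i = i ∧ ∀ x, visits p i (k + 1) x ≤ m x).card =
      m i := by
  set l := Function.minimalPeriod p i with hl
  have hl0 : 0 < l := minimalPeriod_pos p i
  rw [← Finset.card_range (m i)]
  symm
  refine Finset.card_bij (fun q _ => (q + 1) * l - 1) ?_ ?_ ?_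
  · intro q hq
    rw [mem_range] at hq
    have h1 : (q + 1) * l - 1 + 1 = (q + 1) * l := Nat.sub_add_cancel (Nat.mul_pos q.succ_pos hl0)
    have h2 : ∀ x, visits p i ((q + 1) * l) x ≤ m x := by
      intro x
      rw [visits_mul]
      by_cases hx : ∃ j, p^[j] i = x
      · obtain ⟨j, rfl⟩ := hx
        rw [apply_iterate_of_invariant p hm]
        have := visits_minimalPeriod p i (p^[j] i)
        nlinarith
      · have : visits p i (Function.minimalPeriod p i) x = 0 := by
          rw [visits]
          push Not at hx
          simp [hx]
        rw [this]
        simp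
    simp only [mem_filter, mem_range, h1]
    refine ⟨?_, iterate_mul_minimalPeriod p i _, h2⟩
    have := Finset.sum_le_sum fun x (_ : x ∈ univ) => h2 x
    rw [sum_visits, hd] at this
    omega
  · intro a _ b _ h
    have ha : 0 < (a + 1) * l := Nat.mul_pos a.succ_pos hl0
    have hb : 0 < (b + 1) * l := Nat.mul_pos b.succ_pos hl0
    have : (a + 1) * l = (b + 1) * l := by
      omega
    have := Nat.eq_of_mul_eq_mul_right hl0 this
    omega
  · intro k hk
    simp only [mem_filter, mem_range] at hk
    obtain ⟨hk1, hk2, hk3⟩ := hk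
    obtain ⟨q, hq⟩ : l ∣ k + 1 := Function.IsPeriodicPt.minimalPeriod_dvd hk2
    have hq0 : q ≠ 0 := by rintro rfl; simp at hq
    refine ⟨q - 1, ?_, ?_⟩
    · have := hk3 i
      rw [hq, mul_comm, visits_mul, visits_minimalPeriod_self] at this
      rw [mem_range]
      omega
    · have : q - 1 + 1 = q := by omega
      simp only [this]
      rw [mul_comm, ← hq]
      rfl

/-- The trace of a signed permutation with signs `s` on the homogeneous polynomials. -/
def monTrace (s : Fin n → ℂ) (d : ℕ) : ℂ :=
  ∑ m ∈ (piAntidiag univ d).filter fun m : Fin n → ℕ => ∀ i, m (p i) = m i, ∏ i, s i ^ m i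

theorem newton (s : Fin n → ℂ) (d : ℕ) :
    ((d : ℂ) + 1) * monTrace p s (d + 1) = ∑ k ∈ Finset.range (d + 1),
      (∑ i, if p^[k + 1] i = i then ∏ j ∈ Finset.range (k + 1), s (p^[j] i) else 0) *
        monTrace p s (d - k) := by
  have key : ∀ k ∈ Finset.range (d + 1), ∀ i,
      (if p^[k + 1] i = i then ∏ j ∈ Finset.range (k + 1), s (p^[j] i) else 0) *
        monTrace p s (d - k) =
      ∑ m ∈ (piAntidiag univ (d + 1)).filter fun m : Fin n → ℕ => ∀ i, m (p i) = m i,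
        if p^[k + 1] i = i ∧ ∀ x, visits p i (k + 1) x ≤ m x then ∏ i, s i ^ m i else 0 := by
    intro k hk i
    rw [mem_range] at hk
    by_cases h : p^[k + 1] i = i
    · simp only [h, if_true, true_and]
      rw [← Finset.sum_filter, monTrace, Finset.mul_sum, ← prod_pow_visits]
      refine Finset.sum_bij' (fun m _ => fun x => visits p i (k + 1) x + m x)
        (fun m _ => fun x => m x - visits p i (k + 1) x) ?_ ?_ ?_ ?_ ?_
      · intro m hm
        simp only [mem_filter, mem_piAntidiag, mem_univ, implies_true, and_true] at hm ⊢
        refine ⟨⟨?_, fun x => ?_⟩, fun x => Nat.le_add_right _ _⟩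
        · rw [Finset.sum_add_distrib, sum_visits, hm.1]
          omega
        · rw [visits_apply p i _ h, hm.2]
      · intro m hm
        simp only [mem_filter, mem_piAntidiag, mem_univ, implies_true, and_true] at hm ⊢
        refine ⟨?_, fun x => ?_⟩
        · rw [Finset.sum_tsub_distrib _ fun x _ => hm.2 x, sum_visits, hm.1.1]
          omega
        · rw [visits_apply p i _ h, hm.1.2]
      · intro m _
        funext x
        simp
      · intro m hm
        funext x
        exact Nat.add_sub_cancel' ((mem_filter.1 hm).2 x)
      · intro m _
        rw [← Finset.prod_mul_distrib]
        exact Finset.prod_congr rfl fun x _ => (pow_add _ _ _).symm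
    · simp only [h, if_false, false_and, zero_mul, Finset.sum_const_zero]
  simp only [Finset.sum_mul]
  rw [Finset.sum_congr rfl fun k hk => Finset.sum_congr rfl fun i _ => key k hk i]
  rw [Finset.sum_congr rfl fun k _ => Finset.sum_comm, Finset.sum_comm, monTrace, Finset.mul_sum]
  refine Finset.sum_congr rfl fun m hm => ?_
  simp only [mem_filter, mem_piAntidiag, mem_univ, implies_true, and_true] at hm
  rw [Finset.sum_comm]
  simp only [← Finset.sum_filter, Finset.sum_const, nsmul_eq_mul]
  rw [← Finset.sum_mul, ← Nat.cast_sum,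
    Finset.sum_congr rfl fun i _ => card_closed_walks p hm.2 i (d + 1) hm.1, hm.1]
  push_cast
  rfl

theorem monTrace_zero (s : Fin n → ℂ) : monTrace p s 0 = 1 := by
  rw [monTrace, piAntidiag_zero, Finset.filter_singleton, if_pos (by simp), Finset.sum_singleton]
  simp

end Newton

section MonomialActions

variable {n : ℕ}

/-- The action of `W_n` on the monomials in `n` variables. -/
def monAct : SAct (BWn n) (Fin n → ℕ) where
  act g m i := m ((basePerm g)⁻¹ i)
  wt g m := ∏ i, coordSign g i ^ m i
  act_one m := by simp
  wt_one m := by simp [coordSign_one]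
  act_mul g h m := by simp
  wt_mul g h m := by
    simp only [coordSign_mul, mul_pow, Finset.prod_mul_distrib]
    congr 1
    refine Eq.trans ?_ (Equiv.prod_comp (basePerm h) _)
    exact Finset.prod_congr rfl fun i _ => by rw [inv_apply_apply]

/-- The action of `W_n` on the square-free monomials in `n` variables. -/
def setAct : SAct (BWn n) (Finset (Fin n)) where
  act g S := S.map (basePerm g).toEmbedding
  wt g S := ∏ i ∈ S, coordSign g i
  act_one S := by rw [map_one]; exact Finset.map_refl
  wt_one S := by simp [coordSign_one]
  act_mul g h S := by
    rw [map_mul, Finset.map_map]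
    rfl
  wt_mul g h S := by
    simp [coordSign_mul, Finset.prod_mul_distrib, Finset.prod_map]

theorem monAct_act_eq_iff (g : BWn n) (m : Fin n → ℕ) :
    monAct.act g m = m ↔ ∀ i, m (basePerm g i) = m i := by
  refine ⟨fun h i => ?_, fun h => funext fun i => ?_⟩
  · conv_lhs => rw [← h]
    exact congrArg m (inv_apply_apply _ _)
  · change m ((basePerm g)⁻¹ i) = m i
    rw [← h, apply_inv_apply]

theorem setAct_act_eq_iff (g : BWn n) (S : Finset (Fin n)) :
    setAct.act g S = S ↔ ∀ i, basePerm g i ∈ S ↔ i ∈ S := by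
  have e : ∀ i, basePerm g i ∈ setAct.act g S ↔ i ∈ S := fun i =>
    Finset.mem_map' _
  refine ⟨fun h i => ?_, fun h => ?_⟩
  · conv_lhs => rw [← h]
    exact e i
  · ext i
    have h1 := e ((basePerm g)⁻¹ i)
    have h2 := h ((basePerm g)⁻¹ i)
    rw [apply_inv_apply] at h1 h2
    rw [h1, h2]

theorem monAct_wt_mul_self (g : BWn n) (m : Fin n → ℕ) : monAct.wt g m * monAct.wt g m = 1 := by
  rw [monAct, ← Finset.prod_mul_distrib]
  exact Finset.prod_eq_one fun i _ => by rw [← mul_pow, coordSign_mul_self, one_pow]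

theorem setAct_wt_mul_self (g : BWn n) (S : Finset (Fin n)) :
    setAct.wt g S * setAct.wt g S = 1 := by
  rw [setAct, ← Finset.prod_mul_distrib]
  exact Finset.prod_eq_one fun i _ => coordSign_mul_self g i

theorem basePerm_pow_apply (g : BWn n) (k : ℕ) (i : Fin n) :
    basePerm (g ^ k) i = (basePerm g)^[k] i := by
  rw [map_pow, Perm.iterate_eq_pow]

theorem coordSign_pow (g : BWn n) (k : ℕ) (i : Fin n) :
    coordSign (g ^ k) i = ∏ j ∈ Finset.range k, coordSign g ((basePerm g)^[j] i) := by
  induction k with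
  | zero => simp [coordSign_one]
  | succ k ih => rw [pow_succ', coordSign_mul, ih, Finset.prod_range_succ, mul_comm,
      basePerm_pow_apply]

theorem monAct_ch (g : BWn n) (d : ℕ) :
    monAct.ch (piAntidiag univ d) g = monTrace (basePerm g) (coordSign g) d := by
  rw [SAct.ch, monTrace, ← Finset.sum_filter]
  refine Finset.sum_congr (Finset.filter_congr fun m _ => monAct_act_eq_iff g m) fun m _ => rfl

theorem symChar_reflChar (g : BWn n) (d : ℕ) :
    symChar reflChar d (g : PG n) = monAct.ch (piAntidiag univ d) g := by
  induction d using Nat.strong_induction_on with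
  | _ d ih =>
    rw [monAct_ch]
    cases d with
    | zero => rw [symChar, monTrace_zero]
    | succ d =>
      have h0 : (d : ℂ) + 1 ≠ 0 := by exact_mod_cast d.succ_ne_zero
      rw [symChar, inv_mul_eq_iff_eq_mul₀ h0, newton]
      refine Finset.sum_congr rfl fun k _ => ?_
      rw [ih _ (by omega), monAct_ch]
      congr 1
      have := reflChar_eq (g ^ (k + 1))
      rw [Subgroup.coe_pow] at this
      rw [this]
      simp only [basePerm_pow_apply, coordSign_pow]

theorem symChar_resChar {G : Type} [Group G] (H : Subgroup G) (χ : G → ℂ) (d : ℕ) (h : H) :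
    symChar (resChar H χ) d h = symChar χ d (h : G) := by
  induction d using Nat.strong_induction_on with
  | _ d ih =>
    cases d with
    | zero => rw [symChar, symChar]
    | succ d =>
      rw [symChar, symChar]
      congr 1
      refine Finset.sum_congr rfl fun k _ => ?_
      rw [ih _ (by omega)]
      rfl

end MonomialActions

section JacobiTrudi

variable {R : Type*} [CommRing R]

/-- Extension of a sequence by zero to negative indices. -/
def extZ (h : ℕ → R) (k : ℤ) : R := if 0 ≤ k then h k.toNat else 0

theorem extZ_natCast (h : ℕ → R) (k : ℕ) : extZ h (k : ℤ) = h k := by simp [extZ]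

theorem extZ_of_neg (h : ℕ → R) {k : ℤ} (hk : k < 0) : extZ h k = 0 := by
  rw [extZ, if_neg (by omega)]

/-- The lower triangular Toeplitz matrix of a sequence. -/
def toeplitz (h : ℕ → R) (N : ℕ) : Matrix (Fin N) (Fin N) R :=
  Matrix.of fun a b => extZ h ((a : ℕ) - (b : ℕ))

theorem det_toeplitz (h : ℕ → R) (h0 : h 0 = 1) (N : ℕ) : (toeplitz h N).det = 1 := by
  rw [Matrix.det_of_isLowerTriangular]
  · refine Finset.prod_eq_one fun i _ => ?_
    rw [toeplitz, Matrix.of_apply, sub_self, ← Nat.cast_zero, extZ_natCast, h0]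
  · intro a b hab
    rw [toeplitz, Matrix.of_apply]
    refine extZ_of_neg _ ?_
    have : a < b := hab
    have : (a : ℕ) < b := this
    omega

theorem toeplitz_mul (h e : ℕ → R)
    (he : ∀ d, ∑ x ∈ antidiagonal d, h x.1 * e x.2 = if d = 0 then 1 else 0) (N : ℕ) :
    toeplitz h N * toeplitz e N = 1 := by
  ext a b
  rw [Matrix.mul_apply, Matrix.one_apply]
  simp only [toeplitz, Matrix.of_apply]
  by_cases hab : (b : ℕ) ≤ a
  · have h1 := he (a - b)
    have h2 : ((a : ℕ) - b = 0) ↔ a = b := by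
      rw [Fin.ext_iff]; omega
    simp only [h2] at h1
    rw [← h1, Finset.Nat.sum_antidiagonal_eq_sum_range_succ_mk]
    symm
    refine Finset.sum_of_injOn (fun k : ℕ => if hk : k < N then
        (⟨a - k, by omega⟩ : Fin N) else a) ?_ ?_ ?_ ?_
    · intro k hk l hl hkl
      simp only [coe_range, Set.mem_Iio] at hk hl
      have := a.2
      simp only [show k < N by omega, show l < N by omega, dif_pos, Fin.mk.injEq] at hkl
      omega
    · intro _ _; simp
    · intro k _ hk
      by_cases hka : (a : ℕ) < k
      · rw [extZ_of_neg h (by omega), zero_mul]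
      by_cases hkb : (k : ℕ) < b
      · rw [extZ_of_neg e (by omega), mul_zero]
      exfalso
      refine hk ⟨a - k, ?_, ?_⟩
      · simp only [coe_range, Set.mem_Iio]
        omega
      · have := a.2
        simp only [show (a : ℕ) - k < N by omega, dif_pos, Fin.ext_iff]
        omega
    · intro k hk
      rw [mem_range] at hk
      have := a.2
      simp only [show k < N by omega, dif_pos]
      have e1 : ((a : ℕ) : ℤ) - ((a - k : ℕ) : ℤ) = (k : ℕ) := by omega
      have e2 : ((a - k : ℕ) : ℤ) - (b : ℕ) = ((a - b - k : ℕ) : ℤ) := by omega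
      rw [e1, e2, extZ_natCast, extZ_natCast]
  · rw [if_neg (by rintro rfl; exact hab le_rfl)]
    refine Finset.sum_eq_zero fun k _ => ?_
    by_cases hka : (a : ℕ) < k
    · rw [extZ_of_neg h (by omega), zero_mul]
    · rw [extZ_of_neg e (by omega), mul_zero]

/-- The dual Jacobi–Trudi identity for a column. -/
theorem sum_sign_prod_eq (h e : ℕ → R) (h0 : h 0 = 1)
    (he : ∀ d, ∑ x ∈ antidiagonal d, h x.1 * e x.2 = if d = 0 then 1 else 0) (r : ℕ) :
    ∑ σ : Perm (Fin r), ((Perm.sign σ : ℤ) : R) *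
      ∏ i : Fin r, extZ h (1 - ((i : ℕ) : ℤ) + ((σ i : ℕ) : ℤ)) = (-1) ^ r * e r := by
  have h1 : (toeplitz h (r + 1)).adjugate = toeplitz e (r + 1) := by
    have := congrArg ((toeplitz h (r + 1)).adjugate * ·) (toeplitz_mul h e he (r + 1))
    simp only [← mul_assoc, Matrix.adjugate_mul, det_toeplitz h h0, one_smul, mul_one,
      one_mul] at this
    exact this.symm
  have h2 := congrFun (congrFun h1 (Fin.last r)) 0
  rw [Matrix.adjugate_fin_succ_eq_det_submatrix, Matrix.det_apply'] at h2
  have h3 : toeplitz e (r + 1) (Fin.last r) 0 = e r := by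
    rw [toeplitz, Matrix.of_apply, Fin.val_last, Fin.val_zero, Nat.cast_zero, sub_zero,
      extZ_natCast]
  rw [h3, Fin.val_zero, Fin.val_last, zero_add] at h2
  rw [← h2, ← mul_assoc, ← mul_pow, neg_one_mul, neg_neg, one_pow, one_mul]
  refine Finset.sum_congr rfl fun σ _ => ?_
  congr 1
  refine Finset.prod_congr rfl fun i _ => ?_
  rw [Matrix.submatrix_apply, toeplitz, Matrix.of_apply, Fin.succAbove_zero, Fin.succAbove_last,
    Fin.val_succ, Fin.val_castSucc]
  congr 1
  push_cast
  ring

end JacobiTrudi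

section CycleSums

variable {n : ℕ} (p : Perm (Fin n))

/-- The cycle of a permutation through a point. -/
def orb (i : Fin n) : Finset (Fin n) := univ.filter fun j => p.SameCycle i j

theorem mem_orb {i j : Fin n} : j ∈ orb p i ↔ p.SameCycle i j := by simp [orb]

theorem orb_eq_iff {i j : Fin n} : orb p i = orb p j ↔ p.SameCycle i j := by
  refine ⟨fun h => ?_, fun h => ?_⟩
  · rw [← mem_orb, h, mem_orb]
  · ext k
    rw [mem_orb, mem_orb]
    exact ⟨h.symm.trans, h.trans⟩

/-- The number of cycles of a permutation meeting a set. -/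
def numOrb (S : Finset (Fin n)) : ℕ := (S.image (orb p)).card

variable {p} in
theorem mem_of_sameCycle {S : Finset (Fin n)} (hS : ∀ i, p i ∈ S ↔ i ∈ S) {i j : Fin n}
    (h : p.SameCycle i j) : i ∈ S ↔ j ∈ S := by
  obtain ⟨k, rfl⟩ := h
  induction k using Int.induction_on with
  | zero => simp
  | succ k ih => rw [ih, ← hS, add_comm, zpow_add, zpow_one, Perm.mul_apply]
  | pred k ih =>
    rw [ih, ← hS ((p ^ (-(k : ℤ) - 1)) i), ← Perm.mul_apply, ← zpow_one_add]
    congr! 3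
    ring

theorem numOrb_union {S T : Finset (Fin n)} (hS : ∀ i, p i ∈ S ↔ i ∈ S) (h : Disjoint S T) :
    numOrb p (S ∪ T) = numOrb p S + numOrb p T := by
  rw [numOrb, Finset.image_union, Finset.card_union_of_disjoint, numOrb, numOrb]
  rw [Finset.disjoint_left]
  intro o h1 h2
  obtain ⟨i, hi, rfl⟩ := mem_image.1 h1
  obtain ⟨j, hj, e⟩ := mem_image.1 h2
  exact Finset.disjoint_left.1 h ((mem_of_sameCycle hS ((orb_eq_iff p).1 e)).2 hi) hj

theorem numOrb_orb (i : Fin n) : numOrb p (orb p i) = 1 := by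
  rw [numOrb, Finset.card_eq_one]
  refine ⟨orb p i, ?_⟩
  ext o
  rw [mem_image, mem_singleton]
  constructor
  · rintro ⟨j, hj, rfl⟩
    exact ((orb_eq_iff p).2 ((mem_orb p).1 hj)).symm
  · rintro rfl
    exact ⟨i, (mem_orb p).2 (Perm.SameCycle.refl _ _), rfl⟩

theorem sign_eq_neg_one_pow_numOrb : (Perm.sign p : ℤ) = (-1) ^ (n + numOrb p univ) := by
  have h1 : numOrb p univ = numOrb p p.support + numOrb p p.supportᶜ := by
    rw [← numOrb_union p (fun i => Perm.apply_mem_support) disjoint_compl_right,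
      Finset.union_compl]
  have h2 : numOrb p p.supportᶜ = n - p.support.card := by
    rw [numOrb, Finset.card_image_of_injOn, Finset.card_compl, Fintype.card_fin]
    intro i hi j hj hij
    have hi' : p i = i := by simpa using hi
    exact ((orb_eq_iff p).1 hij).eq_of_left hi'
  have h3 : numOrb p p.support = p.cycleFactorsFinset.card := by
    rw [numOrb]
    have : p.cycleFactorsFinset = p.support.image p.cycleOf := by
      ext f
      rw [mem_image]
      constructor
      · intro hf
        have hc := (Perm.mem_cycleFactorsFinset_iff.1 hf).1
        obtain ⟨x, hx⟩ := hc.nonempty_support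
        refine ⟨x, Perm.mem_cycleFactorsFinset_support_le hf hx, ?_⟩
        exact (Perm.cycle_is_cycleOf hx hf).symm
      · rintro ⟨x, hx, rfl⟩
        exact Perm.cycleOf_mem_cycleFactorsFinset_iff.2 hx
    rw [this]
    have h4 : p.support.image (orb p) = (p.support.image p.cycleOf).image Perm.support := by
      rw [Finset.image_image]
      refine Finset.image_congr fun i hi => ?_
      ext j
      rw [mem_orb, Function.comp, Perm.mem_support_cycleOf_iff]
      exact ⟨fun h => ⟨h, hi⟩, fun h => h.1⟩
    rw [h4, Finset.card_image_of_injOn]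
    intro f hf g hg hfg
    rw [← this] at hf hg
    obtain ⟨x, hx⟩ := (Perm.mem_cycleFactorsFinset_iff.1 hf).1.nonempty_support
    rw [Perm.cycle_is_cycleOf hx hf, Perm.cycle_is_cycleOf (hfg ▸ hx) hg]
  have h5 : p.support.card ≤ n := by simpa using Finset.card_le_univ p.support
  rw [Perm.sign_of_cycleType, Perm.sum_cycleType, Perm.cycleType_def, Multiset.card_map,
    h1, h2, h3]
  simp only [Units.val_pow_eq_pow_val, Units.val_neg, Units.val_one]
  rw [Finset.card_val]
  have : n + (p.cycleFactorsFinset.card + (n - p.support.card)) =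
    p.support.card + p.cycleFactorsFinset.card + 2 * (n - p.support.card) := by omega
  rw [this, pow_add _ _ (2 * _), pow_mul]
  simp

variable {R : Type*} [CommRing R]

/-- The trace on complete homogeneous polynomials. -/
def hSum (x : Fin n → R) (d : ℕ) : R :=
  ∑ m ∈ (piAntidiag univ d).filter fun m : Fin n → ℕ => ∀ i, m (p i) = m i, ∏ i, x i ^ m i

/-- The signed trace on elementary polynomials. -/
def eSum (x : Fin n → R) (d : ℕ) : R :=
  ∑ S ∈ (powersetCard d univ).filter fun S : Finset (Fin n) => ∀ i, p i ∈ S ↔ i ∈ S,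
    (-1) ^ numOrb p S * ∏ i ∈ S, x i

theorem hSum_zero (x : Fin n → R) : hSum p x 0 = 1 := by
  rw [hSum, piAntidiag_zero, Finset.filter_singleton, if_pos (by simp), Finset.sum_singleton]
  simp

theorem sum_neg_one_pow_numOrb (T : Finset (Fin n)) (hT : ∀ i, p i ∈ T ↔ i ∈ T)
    (hne : T.Nonempty) :
    ∑ S ∈ T.powerset.filter fun S : Finset (Fin n) => ∀ i, p i ∈ S ↔ i ∈ S,
      (-1 : R) ^ numOrb p S = 0 := by
  obtain ⟨a, ha⟩ := hne
  have hO : ∀ i, p i ∈ orb p a ↔ i ∈ orb p a := fun i => by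
    rw [mem_orb, mem_orb, Perm.sameCycle_apply_right]
  have hOT : orb p a ⊆ T := fun i hi => (mem_of_sameCycle hT ((mem_orb p).1 hi)).1 ha
  have haO : a ∈ orb p a := (mem_orb p).2 (Perm.SameCycle.refl _ _)
  have key : ∀ S : Finset (Fin n), (∀ i, p i ∈ S ↔ i ∈ S) → a ∉ S → Disjoint S (orb p a) := by
    intro S hS haS
    rw [Finset.disjoint_left]
    exact fun i hi hi' => haS ((mem_of_sameCycle hS ((mem_orb p).1 hi')).2 hi)
  have key2 : ∀ S : Finset (Fin n), (∀ i, p i ∈ S ↔ i ∈ S) → a ∈ S → orb p a ⊆ S := by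
    intro S hS haS i hi
    exact (mem_of_sameCycle hS ((mem_orb p).1 hi)).1 haS
  refine Finset.sum_involution (fun S _ => symmDiff S (orb p a)) ?_ ?_ ?_ ?_
  · intro S hS
    have hS' := (mem_filter.1 hS).2
    by_cases haS : a ∈ S
    · have e : symmDiff S (orb p a) = S \ orb p a := symmDiff_of_ge (key2 S hS' haS)
      have h1 : numOrb p S = numOrb p (S \ orb p a) + 1 := by
        rw [← numOrb_orb p a, add_comm, ← numOrb_union p hO disjoint_sdiff,
          Finset.union_sdiff_of_subset (key2 S hS' haS)]
      rw [e, h1, pow_succ]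
      ring
    · have e : symmDiff S (orb p a) = S ∪ orb p a := (key S hS' haS).symmDiff_eq_sup
      rw [e, numOrb_union p hS' (key S hS' haS), numOrb_orb, pow_succ]
      ring
  · intro S _ _ h
    have := Finset.ext_iff.1 h a
    rw [Finset.mem_symmDiff] at this
    tauto
  · intro S hS
    simp only [mem_filter, mem_powerset] at hS ⊢
    refine ⟨?_, fun i => ?_⟩
    · intro i hi
      rw [Finset.mem_symmDiff] at hi
      rcases hi with hi | hi
      · exact hS.1 hi.1
      · exact hOT hi.1
    · rw [Finset.mem_symmDiff, Finset.mem_symmDiff, hS.2, hO]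
  · intro S _
    exact symmDiff_symmDiff_cancel_right _ _

theorem sum_hSum_mul_eSum (x : Fin n → R) (d : ℕ) :
    ∑ y ∈ antidiagonal d, hSum p x y.1 * eSum p x y.2 = if d = 0 then 1 else 0 := by
  have key : ∑ y ∈ antidiagonal d, hSum p x y.1 * eSum p x y.2 =
      ∑ u ∈ (piAntidiag univ d).filter fun m : Fin n → ℕ => ∀ i, m (p i) = m i,
        ∑ S ∈ (univ.filter fun i => u i ≠ 0).powerset.filter
          fun S : Finset (Fin n) => ∀ i, p i ∈ S ↔ i ∈ S,
          (-1) ^ numOrb p S * ∏ i, x i ^ u i := by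
    simp only [hSum, eSum, Finset.sum_mul_sum, ← Finset.sum_product']
    rw [Finset.sum_sigma', Finset.sum_sigma']
    refine Finset.sum_bij' (fun z _ => ⟨fun i => z.2.1 i + if i ∈ z.2.2 then 1 else 0, z.2.2⟩)
      (fun z _ => ⟨(d - z.2.card, z.2.card), (fun i => z.1 i - if i ∈ z.2 then 1 else 0, z.2)⟩)
      ?_ ?_ ?_ ?_ ?_
    · rintro ⟨⟨k, l⟩, m, S⟩ hz
      simp only [mem_sigma, mem_product, HasAntidiagonal.mem_antidiagonal, mem_filter, mem_piAntidiag, mem_univ,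
        implies_true, and_true, mem_powersetCard, subset_univ, true_and, mem_powerset] at hz ⊢
      obtain ⟨hkl, ⟨h1, h2⟩, h3, h4⟩ := hz
      refine ⟨⟨?_, fun i => ?_⟩, fun i hi => ?_, h4⟩
      · rw [Finset.sum_add_distrib, h1]
        simp [h3, hkl]
      · simp only [h2, h4]
      · simp [hi]
    · rintro ⟨u, S⟩ hz
      simp only [mem_sigma, mem_product, HasAntidiagonal.mem_antidiagonal, mem_filter, mem_piAntidiag, mem_univ,
        implies_true, and_true, mem_powersetCard, subset_univ, true_and, mem_powerset] at hz ⊢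
      obtain ⟨⟨h1, h2⟩, h3, h4⟩ := hz
      have h5 : ∀ i, (if i ∈ S then 1 else 0) ≤ u i := by
        intro i
        split_ifs with hi
        · have := h3 hi
          simp only [mem_filter, mem_univ, true_and] at this
          omega
        · exact Nat.zero_le _
      have h6 : ∑ i, (if i ∈ S then 1 else 0) = S.card := by simp
      have h7 : S.card ≤ d := by
        rw [← h1, ← h6]
        exact Finset.sum_le_sum fun i _ => h5 i
      refine ⟨by omega, ⟨?_, fun i => by simp only [h2, h4]⟩, h4⟩
      rw [Finset.sum_tsub_distrib _ fun i _ => h5 i, h1, h6]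
    · rintro ⟨⟨k, l⟩, m, S⟩ hz
      simp only [mem_sigma, mem_product, HasAntidiagonal.mem_antidiagonal, mem_filter, mem_piAntidiag, mem_univ,
        implies_true, and_true, mem_powersetCard, subset_univ, true_and] at hz
      obtain ⟨hkl, ⟨h1, h2⟩, h3, h4⟩ := hz
      have : k = d - l := by omega
      subst this
      simp [h3]
    · rintro ⟨u, S⟩ hz
      simp only [mem_sigma, mem_filter, mem_powerset] at hz
      have h5 : ∀ i, (if i ∈ S then 1 else 0) ≤ u i := by
        intro i
        split_ifs with hi
        · have := hz.2.1 hi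
          simp only [mem_filter, mem_univ, true_and] at this
          omega
        · exact Nat.zero_le _
      simp only [Nat.sub_add_cancel (h5 _)]
    · rintro ⟨⟨k, l⟩, m, S⟩ hz
      simp only [pow_add, Finset.prod_mul_distrib]
      simp only [pow_ite, pow_one, pow_zero, Finset.prod_ite_mem, Finset.univ_inter]
      ring
  rw [key]
  split_ifs with hd
  · subst hd
    rw [piAntidiag_zero, Finset.filter_singleton, if_pos (by simp), Finset.sum_singleton]
    simp [Finset.filter_singleton, numOrb]
  · refine Finset.sum_eq_zero fun u hu => ?_
    simp only [mem_filter, mem_piAntidiag, mem_univ, implies_true, and_true] at hu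
    rw [← Finset.sum_mul, sum_neg_one_pow_numOrb, zero_mul]
    · intro i
      simp [hu.2]
    · by_contra h
      rw [Finset.not_nonempty_iff_eq_empty, Finset.filter_eq_empty_iff] at h
      refine hd (hu.1.symm.trans (Finset.sum_eq_zero fun i hi => not_not.1 (h hi)))

/-- The Jacobi–Trudi identity for the traces of a permutation. -/
theorem sum_sign_prod_hSum (x : Fin n → R) (r : ℕ) :
    ∑ σ : Perm (Fin r), ((Perm.sign σ : ℤ) : R) *
      ∏ i : Fin r, extZ (hSum p x) (1 - ((i : ℕ) : ℤ) + ((σ i : ℕ) : ℤ)) =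
      (-1) ^ r * eSum p x r :=
  sum_sign_prod_eq _ _ (hSum_zero p x) (sum_hSum_mul_eSum p x) r

end CycleSums

section SquareFree

variable {n : ℕ}

/-- The exponent of the monomial `x₁⋯xₙ`. -/
def ones (n : ℕ) : Fin n →₀ ℕ := Finsupp.indicator univ fun _ _ => 1

/-- The variables scaled by the entries of `s`. -/
def scaledX (s : Fin n → ℂ) (i : Fin n) : MvPolynomial (Fin n) ℂ :=
  MvPolynomial.C (s i) * MvPolynomial.X i

theorem coeff_ones_prod (a : Fin n → ℂ) (u : Fin n → ℕ) :
    MvPolynomial.coeff (ones n)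
      (∏ i, (MvPolynomial.C (a i) * MvPolynomial.X i ^ u i : MvPolynomial (Fin n) ℂ)) =
      if ∀ i, u i = 1 then ∏ i, a i else 0 := by
  rw [Finset.prod_mul_distrib, ← map_prod, MvPolynomial.coeff_C_mul, MvPolynomial.prod_X_pow,
    MvPolynomial.coeff_monomial]
  have : Finsupp.indicator univ (fun i _ => u i) = ones n ↔ ∀ i, u i = 1 := by
    rw [DFunLike.ext_iff]
    simp [ones]
  simp only [this]
  split_ifs <;> simp

variable (p : Perm (Fin n))

theorem coeff_ones_prod_hSum {J : Type} [Fintype J] [DecidableEq J] (s : J → Fin n → ℂ)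
    (c : J → ℕ) :
    MvPolynomial.coeff (ones n) (∏ j, hSum p (scaledX (s j)) (c j)) =
      ∑ F ∈ univ.filter fun F : Fin n → J => ∀ j, (univ.filter fun i => F i = j).card = c j,
        if ∀ i, F (p i) = F i then ∏ i, s (F i) i else 0 := by
  classical
  simp only [hSum]
  rw [Finset.prod_univ_sum, MvPolynomial.coeff_sum]
  have h1 : ∀ M : J → Fin n → ℕ, (∏ j, ∏ i, scaledX (s j) i ^ M j i : MvPolynomial (Fin n) ℂ) =
      ∏ i, (MvPolynomial.C (∏ j, s j i ^ M j i) * MvPolynomial.X i ^ ∑ j, M j i) := by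
    intro M
    rw [Finset.prod_comm]
    refine Finset.prod_congr rfl fun i _ => ?_
    rw [map_prod, ← Finset.prod_pow_eq_pow_sum, ← Finset.prod_mul_distrib]
    exact Finset.prod_congr rfl fun j _ => by rw [scaledX, mul_pow, map_pow]
  simp only [h1, coeff_ones_prod]
  rw [← Finset.sum_filter, ← Finset.sum_filter, Finset.filter_filter]
  symm
  refine Finset.sum_bij (fun F _ => fun j i => if F i = j then 1 else 0) ?_ ?_ ?_ ?_
  · intro F hF
    simp only [mem_filter, mem_univ, true_and] at hF
    simp only [mem_filter, Fintype.mem_piFinset, mem_piAntidiag, mem_univ, implies_true, and_true]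
    refine ⟨fun j => ⟨?_, fun i => by rw [hF.2]⟩, fun i => by simp⟩
    rw [← hF.1 j, Finset.card_filter]
  · intro F _ F' _ h
    funext i
    have := congrFun (congrFun h (F' i)) i
    simpa using this
  · intro M hM
    simp only [mem_filter, Fintype.mem_piFinset, mem_piAntidiag, mem_univ, implies_true,
      and_true] at hM
    have hex : ∀ i, ∃ j, M j i = 1 := by
      intro i
      by_contra hc
      push Not at hc
      have h0 : ∀ j, M j i = 0 := by
        intro j
        have h2 : M j i ≤ ∑ j, M j i :=
          Finset.single_le_sum (f := fun j => M j i) (fun _ _ => Nat.zero_le _) (mem_univ j)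
        have := hc j
        rw [hM.2] at h2
        omega
      have := hM.2 i
      simp [h0] at this
    choose F hF using hex
    have hM' : ∀ j i, M j i = if F i = j then 1 else 0 := by
      intro j i
      split_ifs with h
      · rw [← h, hF]
      · have h2 := Finset.add_sum_erase univ (fun j => M j i) (mem_univ (F i))
        rw [hM.2, hF] at h2
        have h3 : M j i ≤ ∑ j ∈ univ.erase (F i), M j i :=
          Finset.single_le_sum (f := fun j => M j i) (fun _ _ => Nat.zero_le _)
            (mem_erase.2 ⟨fun e => h e.symm, mem_univ j⟩)
        omega
    refine ⟨F, ?_, ?_⟩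
    · simp only [mem_filter, mem_univ, true_and]
      refine ⟨fun j => ?_, fun i => ?_⟩
      · rw [← (hM.1 j).1, Finset.card_filter]
        exact Finset.sum_congr rfl fun i _ => (hM' j i).symm
      · have := (hM.1 (F i)).2 i
        rw [hF, hM'] at this
        by_contra hc
        rw [if_neg hc] at this
        exact zero_ne_one this
    · funext j i
      exact (hM' j i).symm
  · intro F _
    refine Finset.prod_congr rfl fun i _ => ?_
    simp [pow_ite]

theorem coeff_ones_eSum_mul_eSum (s t : Fin n → ℂ) (a b : ℕ) (hab : a + b = n) :
    MvPolynomial.coeff (ones n) (eSum p (scaledX s) a * eSum p (scaledX t) b) =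
      (-1) ^ numOrb p univ * ∑ B ∈ powersetCard b univ,
        if ∀ i, p i ∈ B ↔ i ∈ B then (∏ i ∈ Bᶜ, s i) * ∏ i ∈ B, t i else 0 := by
  have h1 : ∀ S T : Finset (Fin n), MvPolynomial.coeff (ones n)
      (((-1) ^ numOrb p S * ∏ i ∈ S, scaledX s i) * ((-1) ^ numOrb p T * ∏ i ∈ T, scaledX t i)) =
      if S = Tᶜ then (-1) ^ (numOrb p S + numOrb p T) * ((∏ i ∈ S, s i) * ∏ i ∈ T, t i)
        else 0 := by
    intro S T
    have e : (((-1) ^ numOrb p S * ∏ i ∈ S, scaledX s i) *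
        ((-1) ^ numOrb p T * ∏ i ∈ T, scaledX t i) : MvPolynomial (Fin n) ℂ) =
        MvPolynomial.C ((-1) ^ (numOrb p S + numOrb p T)) *
        ∏ i, (MvPolynomial.C ((if i ∈ S then s i else 1) * if i ∈ T then t i else 1) *
          MvPolynomial.X i ^ ((if i ∈ S then 1 else 0) + if i ∈ T then 1 else 0)) := by
      simp only [map_pow, map_neg, map_one, map_mul, pow_add, Finset.prod_mul_distrib, scaledX,
        apply_ite MvPolynomial.C, pow_ite, pow_one, pow_zero, Finset.prod_ite_mem,
        Finset.univ_inter]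
      ring
    rw [e, MvPolynomial.coeff_C_mul, coeff_ones_prod]
    have h2 : (∀ i, ((if i ∈ S then 1 else 0) + if i ∈ T then 1 else 0) = 1) ↔ S = Tᶜ := by
      rw [Finset.ext_iff]
      refine forall_congr' fun i => ?_
      rw [mem_compl]
      by_cases hS : i ∈ S <;> by_cases hT : i ∈ T <;> simp [hS, hT]
    simp only [h2]
    split_ifs
    · rw [Finset.prod_mul_distrib, Finset.prod_ite_mem, Finset.prod_ite_mem, Finset.univ_inter,
        Finset.univ_inter]
    · rw [mul_zero]
  rw [eSum, eSum, Finset.sum_mul_sum, MvPolynomial.coeff_sum, Finset.sum_congr rfl fun S _ =>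
    MvPolynomial.coeff_sum _ _ _, Finset.sum_comm]
  simp only [h1, Finset.sum_ite_eq']
  rw [Finset.mul_sum, Finset.sum_filter]
  refine Finset.sum_congr rfl fun B hB => ?_
  simp only [mem_powersetCard, subset_univ, true_and] at hB
  by_cases hB' : ∀ i, p i ∈ B ↔ i ∈ B
  · have hBc : ∀ i, p i ∈ Bᶜ ↔ i ∈ Bᶜ := fun i => by rw [mem_compl, mem_compl, hB']
    rw [if_pos hB', if_pos hB', if_pos, ← numOrb_union p hBc disjoint_compl_left,
      Finset.union_comm, union_compl]
    simp only [mem_filter, mem_powersetCard, subset_univ, true_and]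
    refine ⟨?_, hBc⟩
    rw [Finset.card_compl, Fintype.card_fin]
    omega
  · rw [if_neg hB', if_neg hB', mul_zero]

end SquareFree

section Blocks

theorem blockOf_eq {N : ℕ} {cs : ℕ → ℕ} {i b : ℕ} (hb : b < N)
    (h1 : ∑ b' ∈ Finset.range b, cs b' ≤ i) (h2 : i < ∑ b' ∈ Finset.range (b + 1), cs b') :
    blockOf N cs i = b := by
  have : ((Finset.range N).filter fun b => ∑ b' ∈ Finset.range (b + 1), cs b' ≤ i) =
      Finset.range b := by
    ext a
    rw [mem_filter, mem_range, mem_range]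
    constructor
    · rintro ⟨_, h⟩
      by_contra hab
      have : ∑ b' ∈ Finset.range (b + 1), cs b' ≤ ∑ b' ∈ Finset.range (a + 1), cs b' :=
        Finset.sum_le_sum_of_subset (Finset.range_mono (by omega))
      omega
    · intro h
      have : ∑ b' ∈ Finset.range (a + 1), cs b' ≤ ∑ b' ∈ Finset.range b, cs b' :=
        Finset.sum_le_sum_of_subset (Finset.range_mono (by omega))
      omega
  rw [blockOf, this, card_range]

theorem exists_block {N : ℕ} {cs : ℕ → ℕ} {i : ℕ} (hi : i < ∑ b ∈ Finset.range N, cs b) :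
    ∃ b < N, ∑ b' ∈ Finset.range b, cs b' ≤ i ∧ i < ∑ b' ∈ Finset.range (b + 1), cs b' := by
  induction N with
  | zero => simp at hi
  | succ N ih =>
    by_cases h : i < ∑ b ∈ Finset.range N, cs b
    · obtain ⟨b, hb, h'⟩ := ih h
      exact ⟨b, by omega, h'⟩
    · exact ⟨N, by omega, by omega, hi⟩

theorem blockOf_lt {N : ℕ} {cs : ℕ → ℕ} {i : ℕ} (hi : i < ∑ b ∈ Finset.range N, cs b) :
    blockOf N cs i < N := by
  obtain ⟨b, hb, h1, h2⟩ := exists_block hi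
  rwa [blockOf_eq hb h1 h2]

theorem card_blockOf_eq {n N : ℕ} {cs : ℕ → ℕ} (hn : ∑ b ∈ Finset.range N, cs b = n) {b : ℕ}
    (hb : b < N) : (univ.filter fun i : Fin n => blockOf N cs i = b).card = cs b := by
  have e : (univ.filter fun i : Fin n => blockOf N cs i = b).map Fin.valEmbedding =
      Finset.Ico (∑ b' ∈ Finset.range b, cs b') (∑ b' ∈ Finset.range (b + 1), cs b') := by
    ext i
    simp only [mem_map, mem_filter, mem_univ, true_and, Fin.valEmbedding_apply, mem_Ico]
    constructor
    · rintro ⟨i, h, rfl⟩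
      obtain ⟨b', hb', h1, h2⟩ := exists_block (i.2.trans_eq hn.symm)
      rw [blockOf_eq hb' h1 h2] at h
      rw [← h]
      exact ⟨h1, h2⟩
    · rintro ⟨h1, h2⟩
      have : ∑ b' ∈ Finset.range (b + 1), cs b' ≤ ∑ b' ∈ Finset.range N, cs b' :=
        Finset.sum_le_sum_of_subset (Finset.range_mono (by omega))
      exact ⟨⟨i, by omega⟩, blockOf_eq hb h1 h2, rfl⟩
  rw [← Finset.card_map Fin.valEmbedding, e, Nat.card_Ico, Finset.sum_range_succ]
  omega

theorem exists_perm_comp_eq {n : ℕ} {J : Type} [DecidableEq J] (f F : Fin n → J)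
    (h : ∀ j, (univ.filter fun i => F i = j).card = (univ.filter fun i => f i = j).card) :
    ∃ q : Perm (Fin n), ∀ i, f (q i) = F i := by
  have e : ∀ j, Nonempty ({i // F i = j} ≃ {i // f i = j}) := fun j => by
    rw [← Fintype.card_eq, Fintype.card_subtype, Fintype.card_subtype, h]
  refine ⟨(Equiv.sigmaFiberEquiv F).symm.trans
    ((Equiv.sigmaCongrRight fun j => (e j).some).trans (Equiv.sigmaFiberEquiv f)), fun i => ?_⟩
  exact ((e (F i)).some ⟨i, rfl⟩).2

theorem sum_comp_basePerm {n : ℕ} {J : Type} [Fintype J] [DecidableEq J] [Fintype (BWn n)]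
    (f : Fin n → J) (Φ : (Fin n → J) → ℂ) :
    ∑ x : BWn n, Φ (fun i => f (basePerm x i)) =
      ((univ.filter fun x : BWn n => ∀ i, f (basePerm x i) = f i).card : ℂ) *
        ∑ F ∈ univ.filter fun F : Fin n → J =>
          ∀ j, (univ.filter fun i => F i = j).card = (univ.filter fun i => f i = j).card, Φ F := by
  classical
  rw [← Finset.sum_fiberwise_of_maps_to (g := fun x : BWn n => fun i => f (basePerm x i))
    (t := univ.filter fun F : Fin n → J =>
          ∀ j, (univ.filter fun i => F i = j).card = (univ.filter fun i => f i = j).card),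
    Finset.mul_sum]
  · refine Finset.sum_congr rfl fun F hF => ?_
    obtain ⟨q, hq⟩ := exists_perm_comp_eq f F (mem_filter.1 hF).2
    rw [Finset.sum_congr rfl (g := fun _ => Φ F) fun x hx => by rw [(mem_filter.1 hx).2],
      Finset.sum_const, nsmul_eq_mul]
    congr 2
    refine Finset.card_bij' (fun x _ => x * (permB q)⁻¹) (fun x _ => x * permB q) ?_ ?_ ?_ ?_
    · intro x hx
      simp only [mem_filter, mem_univ, true_and] at hx ⊢
      intro i
      have := congrFun hx (q⁻¹ i)
      rw [map_mul, map_inv, basePerm_permB, Perm.mul_apply, this, ← hq, apply_inv_apply]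
    · intro x hx
      simp only [mem_filter, mem_univ, true_and] at hx ⊢
      funext i
      rw [map_mul, basePerm_permB, Perm.mul_apply, hx, hq]
    · intro x _; simp
    · intro x _; simp
  · intro x _
    simp only [mem_filter, mem_univ, true_and]
    intro j
    refine Finset.card_bij' (fun i _ => basePerm x i) (fun i _ => (basePerm x)⁻¹ i) ?_ ?_ ?_ ?_
    · intro i hi
      simpa using hi
    · intro i hi
      simpa using hi
    · intro i _; simp
    · intro i _; simp

end Blocks

section SymbolCharacter

variable {n : ℕ}

theorem epsOn_eq (T : Set (Fin n)) [DecidablePred (· ∈ T)] (g : BWn n) :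
    epsOn T (g : PG n) = ∏ i, if i ∈ T then coordSign g i else 1 := by
  rw [epsOn, finprod_eq_prod_of_fintype]
  refine Finset.prod_congr rfl fun i _ => ?_
  rcases apply_inl g i with ⟨h1, h2⟩ | ⟨h1, h2⟩
  · simp [h1, h2]
  · simp [h1, h2]

theorem coordSign_conj (x g : BWn n) (k : Fin n) :
    coordSign (x * g * x⁻¹) (basePerm x k) =
      coordSign x (basePerm g k) * coordSign g k * coordSign x k := by
  have h1 : coordSign x⁻¹ (basePerm x k) = coordSign x k := by
    have h := coordSign_mul x⁻¹ x k
    rw [inv_mul_cancel, coordSign_one] at h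
    have h' := coordSign_mul_self x k
    linear_combination (-coordSign x⁻¹ (basePerm x k)) * h' - coordSign x k * h
  rw [coordSign_mul, coordSign_mul, h1, map_inv, inv_apply_apply]

/-- The position of a block in the concatenation of two families of blocks. -/
def blockLabel (r s : ℕ) : Fin r ⊕ Fin s → ℕ := Sum.elim (fun i => (i : ℕ)) (fun j => r + (j : ℕ))

theorem blockLabel_injective (r s : ℕ) : Function.Injective (blockLabel r s) := by
  rintro (a | a) (b | b) h <;> simp only [blockLabel, Sum.elim_inl, Sum.elim_inr] at h
  · rw [Fin.ext h]
  · omega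
  · omega
  · rw [Fin.ext (Nat.add_left_cancel h)]

theorem indChar_blocks {r s : ℕ} (f : Fin n → Fin r ⊕ Fin s) (g : BWn n) :
    indChar (blkSub n (fun i => blockLabel r s (f i)) (fun _ => BTy.B)) (BWn n)
      (resChar _ (epsOn {i | r ≤ blockLabel r s (f i)})) g =
    ∑ F ∈ univ.filter fun F : Fin n → Fin r ⊕ Fin s =>
        ∀ j, (univ.filter fun i => F i = j).card = (univ.filter fun i => f i = j).card,
      if ∀ i, F (basePerm g i) = F i then
        ∏ i, (Sum.elim (fun _ _ => 1) (fun _ => coordSign g) : _ → Fin n → ℂ) (F i) i else 0 := by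
  classical
  have := Fintype.ofFinite (BWn n)
  have hvi := blockLabel_injective r s
  set v := blockLabel r s with hv
  have hvr : ∀ j, r ≤ v j ↔ ∃ b, j = Sum.inr b := by
    rintro (a | a) <;> simp [hv, blockLabel]
  set H := blkSub n (fun i => v (f i)) (fun _ => BTy.B) with hH
  have hmem : ∀ x : BWn n, ((x : PG n)) ∈ H ↔ ∀ i, f (basePerm x i) = f i := fun x => by
    rw [hH, mem_blkSub_B_iff]
    simp only [hvi.eq_iff]
  rw [indChar, finsum_eq_sum_of_fintype]
  have hcard : (Nat.card H : ℂ) =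
      ((univ.filter fun x : BWn n => ∀ i, f (basePerm x i) = f i).card : ℂ) := by
    rw [← Fintype.card_subtype, ← Nat.card_eq_fintype_card]
    congr 1
    refine Nat.card_congr ⟨fun h => ⟨⟨h, mem_BWn_of_mem_blkSub h.2⟩, (hmem _).1 h.2⟩,
      fun x => ⟨x.1, (hmem _).2 x.2⟩, fun _ => rfl, fun _ => rfl⟩
  have hH0 : (Nat.card H : ℂ) ≠ 0 := Nat.cast_ne_zero.2 Nat.card_pos.ne'
  rw [inv_mul_eq_iff_eq_mul₀ hH0, hcard, ← sum_comp_basePerm f fun F =>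
    if ∀ i, F (basePerm g i) = F i then
        ∏ i, (Sum.elim (fun _ _ => 1) (fun _ => coordSign g) : _ → Fin n → ℂ) (F i) i else 0]
  refine Finset.sum_congr rfl fun x _ => ?_
  have hconj : (x : PG n) * g * (x : PG n)⁻¹ = ((x * g * x⁻¹ : BWn n) : PG n) := rfl
  have hiff : (x : PG n) * g * (x : PG n)⁻¹ ∈ H ↔
      ∀ i, f (basePerm x (basePerm g i)) = f (basePerm x i) := by
    rw [hconj, hmem, ← (basePerm x).forall_congr_right]
    simp
  by_cases h : ∀ i, f (basePerm x (basePerm g i)) = f (basePerm x i)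
  · rw [dif_pos (hiff.2 h), if_pos h]
    change epsOn _ ((x * g * x⁻¹ : BWn n) : PG n) = _
    rw [epsOn_eq, ← Equiv.prod_comp (basePerm x)]
    have h1 : ∀ k, (if basePerm x k ∈ {i | r ≤ v (f i)} then
        coordSign (x * g * x⁻¹) (basePerm x k) else 1) =
        (if r ≤ v (f (basePerm x (basePerm g k))) then coordSign x (basePerm g k) else 1) *
        (if r ≤ v (f (basePerm x k)) then coordSign x k else 1) *
        (Sum.elim (fun _ _ => 1) (fun _ => coordSign g) : _ → Fin n → ℂ) (f (basePerm x k)) k := by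
      intro k
      rw [coordSign_conj, h k]
      change (if r ≤ v (f (basePerm x k)) then _ else _) = _
      by_cases hk : r ≤ v (f (basePerm x k))
      · obtain ⟨b, hb⟩ := (hvr _).1 hk
        rw [if_pos hk, if_pos hk, if_pos hk, hb, Sum.elim_inr]
        ring
      · rw [if_neg hk, if_neg hk, if_neg hk]
        rw [hvr] at hk
        push Not at hk
        cases hfk : f (basePerm x k) with
        | inl a => simp
        | inr b => exact absurd hfk (hk b)
    rw [Finset.prod_congr rfl fun k _ => h1 k, Finset.prod_mul_distrib, Finset.prod_mul_distrib,
      Equiv.prod_comp (basePerm g)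
        (fun k => if r ≤ v (f (basePerm x k)) then coordSign x k else 1),
      ← Finset.prod_mul_distrib, Finset.prod_eq_one, one_mul]
    intro k _
    split_ifs
    · exact coordSign_mul_self x k
    · rw [one_mul]
  · rw [dif_neg (fun hc => h (hiff.1 hc)), if_neg h]

theorem indPiece_eq (r s : ℕ) (c : Fin r → ℤ) (d : Fin s → ℤ)
    (hcd : (∑ i, c i) + ∑ j, d j = (n : ℤ)) (g : BWn n) :
    indPiece n r s c d g = MvPolynomial.coeff (ones n)
      ((∏ i, extZ (hSum (basePerm g) (scaledX fun _ => 1)) (c i)) *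
        ∏ j, extZ (hSum (basePerm g) (scaledX (coordSign g))) (d j)) := by
  classical
  by_cases hpos : (∀ i, 0 ≤ c i) ∧ ∀ j, 0 ≤ d j
  · rw [indPiece, if_pos ⟨hpos.1, hpos.2, hcd⟩]
    lift c to Fin r → ℕ using hpos.1
    lift d to Fin s → ℕ using hpos.2
    simp only [extZ_natCast, Int.toNat_natCast]
    set cs : ℕ → ℕ := fun b => if hb : b < r then c ⟨b, hb⟩ else
      if hb' : b - r < s then d ⟨b - r, hb'⟩ else 0 with hcs
    have hcs1 : ∀ i : Fin r, cs i = c i := fun i => by simp [hcs]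
    have hcs2 : ∀ j : Fin s, cs (r + j) = d j := fun j => by simp [hcs]
    have hsum : ∑ b ∈ Finset.range (r + s), cs b = n := by
      rw [Finset.sum_range_add, Finset.sum_range, Finset.sum_range]
      simp only [hcs1, hcs2]
      have hcd' : ∑ i, (c i : ℤ) + ∑ j, (d j : ℤ) = n := hcd
      exact_mod_cast hcd'
    have hex : ∀ i : Fin n, ∃ j, blockLabel r s j = blockOf (r + s) cs i := fun i => by
      have hlt : blockOf (r + s) cs i < r + s := blockOf_lt (i.2.trans_eq hsum.symm)
      by_cases h : blockOf (r + s) cs i < r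
      · exact ⟨Sum.inl ⟨_, h⟩, rfl⟩
      · exact ⟨Sum.inr ⟨blockOf (r + s) cs i - r, by omega⟩, by simp [blockLabel]; omega⟩
    choose f hf using hex
    have hfib : ∀ j, (univ.filter fun i => f i = j).card = Sum.elim c d j := by
      have hvi := blockLabel_injective r s
      intro j
      have h1 := card_blockOf_eq hsum (b := blockLabel r s j)
        (by rcases j with j | j <;> simp [blockLabel]; omega)
      simp only [← hf, hvi.eq_iff] at h1
      rw [h1]
      rcases j with j | j
      · exact hcs1 j
      · exact hcs2 j
    have hcongr : ∀ f₁ f₂ : Fin n → ℕ, f₁ = f₂ →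
        indChar (blkSub n f₁ fun _ => BTy.B) (BWn n) (resChar _ (epsOn {i | r ≤ f₁ i})) g =
        indChar (blkSub n f₂ fun _ => BTy.B) (BWn n) (resChar _ (epsOn {i | r ≤ f₂ i})) g := by
      rintro _ _ rfl
      rfl
    refine (hcongr _ _ (funext fun i => (hf i).symm)).trans ((indChar_blocks f g).trans ?_)
    have h2 := coeff_ones_prod_hSum (basePerm g)
      (Sum.elim (fun _ _ => 1) (fun _ => coordSign g) : Fin r ⊕ Fin s → Fin n → ℂ) (Sum.elim c d)
    rw [Fintype.prod_sum_type] at h2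
    simp only [Sum.elim_inl, Sum.elim_inr] at h2
    rw [h2]
    simp only [hfib]
  · rw [indPiece, if_neg fun h => hpos ⟨h.1, h.2.1⟩]
    symm
    rw [not_and_or] at hpos
    push Not at hpos
    rcases hpos with ⟨i, hi⟩ | ⟨j, hj⟩
    · rw [Finset.prod_eq_zero (mem_univ i) (extZ_of_neg _ hi), zero_mul, MvPolynomial.coeff_zero]
      rfl
    · rw [Finset.prod_eq_zero (mem_univ j) (extZ_of_neg _ hj), mul_zero, MvPolynomial.coeff_zero]
      rfl

theorem chiB_one_one (r s : ℕ) (hn : r + s = n) (g : BWn n) :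
    chiB n r s (fun _ => 1) (fun _ => 1) g =
      (Perm.sign (basePerm g) : ℤ) * setAct.ch (powersetCard s univ) g := by
  have key : ∀ (σ : Perm (Fin r)) (τ : Perm (Fin s)),
      indPiece n r s (fun i => 1 - (i : ℕ) + ((σ i : ℕ) : ℤ)) (fun j => 1 - (j : ℕ) + ((τ j : ℕ) : ℤ)) g =
      MvPolynomial.coeff (ones n)
      ((∏ i : Fin r, extZ (hSum (basePerm g) (scaledX fun _ => 1)) (1 - (i : ℕ) + ((σ i : ℕ) : ℤ))) *
        ∏ j : Fin s, extZ (hSum (basePerm g) (scaledX (coordSign g)))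
          (1 - (j : ℕ) + ((τ j : ℕ) : ℤ))) := by
    intro σ τ
    apply indPiece_eq
    rw [Finset.sum_add_distrib, Finset.sum_add_distrib, Finset.sum_sub_distrib,
      Finset.sum_sub_distrib, Equiv.sum_comp σ fun i => ((i : ℕ) : ℤ),
      Equiv.sum_comp τ fun i => ((i : ℕ) : ℤ)]
    simp only [sum_const, card_univ, Fintype.card_fin, nsmul_eq_mul, mul_one]
    rw [← hn]
    push_cast
    ring
  simp only [chiB, finsum_eq_sum_of_fintype, key]
  have h1 : ∀ (σ : Perm (Fin r)) (τ : Perm (Fin s)) (P Q : MvPolynomial (Fin n) ℂ),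
      (((Perm.sign σ : ℤ) * (Perm.sign τ : ℤ) : ℤ) : ℂ) * MvPolynomial.coeff (ones n) (P * Q) =
      MvPolynomial.coeff (ones n) ((((Perm.sign σ : ℤ) : MvPolynomial (Fin n) ℂ) * P) *
        (((Perm.sign τ : ℤ) : MvPolynomial (Fin n) ℂ) * Q)) := by
    intro σ τ P Q
    rw [← MvPolynomial.coeff_C_mul]
    congr 1
    simp only [Int.cast_mul, map_mul, map_intCast]
    ring
  simp only [h1, ← MvPolynomial.coeff_sum]
  rw [← Finset.sum_mul_sum, sum_sign_prod_hSum, sum_sign_prod_hSum]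
  have h2 : ∀ P Q : MvPolynomial (Fin n) ℂ, ((-1) ^ r * P) * ((-1) ^ s * Q) =
      MvPolynomial.C ((-1) ^ n) * (P * Q) := by
    intro P Q
    have h3 : (-1 : MvPolynomial (Fin n) ℂ) ^ n = (-1) ^ r * (-1) ^ s := by rw [← pow_add, hn]
    rw [map_pow, map_neg, map_one, h3]
    ring
  rw [h2, MvPolynomial.coeff_C_mul, coeff_ones_eSum_mul_eSum _ _ _ _ _ hn, ← mul_assoc, ← pow_add,
    sign_eq_neg_one_pow_numOrb, SAct.ch]
  congr 1
  · push_cast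
    rfl
  · refine Finset.sum_congr rfl fun B _ => ?_
    simp only [setAct_act_eq_iff, Finset.prod_const_one, one_mul]
    rfl

theorem chiBSymbol_eq (c : ℕ) (hn : n = 2 * c + 1) (g : BWn n) :
    chiBSymbol n c (fun t => (t : ℕ) + 1) (fun t => (t : ℕ) + 1) g =
      (Perm.sign (basePerm g) : ℤ) * setAct.ch (powersetCard c univ) g := by
  rw [← chiB_one_one (c + 1) c (by omega), chiBSymbol]
  congr 1
  all_goals
    funext i
    push_cast
    ring

end SymbolCharacter

section Characters

variable {n : ℕ}

/-- The sign of the underlying permutation. -/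
def signHom (n : ℕ) : BWn n →* ℂ where
  toFun g := ((Perm.sign (basePerm g) : ℤ) : ℂ)
  map_one' := by simp
  map_mul' g h := by simp

/-- The sign character of `W_n`. -/
def sgnHom (n : ℕ) : BWn n →* ℂ where
  toFun g := ((Perm.sign (basePerm g) : ℤ) : ℂ) * ∏ i, coordSign g i
  map_one' := by simp [coordSign_one]
  map_mul' g h := by
    simp only [coordSign_mul, Finset.prod_mul_distrib,
      Equiv.prod_comp (basePerm h) fun i => coordSign g i]
    simp
    ring

theorem signHom_apply (g : BWn n) : signHom n g = ((Perm.sign (basePerm g) : ℤ) : ℂ) := rfl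

theorem sgnHom_apply (g : BWn n) :
    sgnHom n g = ((Perm.sign (basePerm g) : ℤ) : ℂ) * ∏ i, coordSign g i := rfl

theorem signHom_mul_self (g : BWn n) : signHom n g * signHom n g = 1 := by
  rw [signHom_apply, ← Int.cast_mul, ← Units.val_mul, Int.units_mul_self]
  simp

/-- The subsets of `Fin n`, twisted by the sign of the underlying permutation: the `c`-element
subsets afford the character of the bipartition `(1^{n-c}, 1^c)`. -/
def signedSetAct (n : ℕ) : SAct (BWn n) (Finset (Fin n)) := setAct.twist (signHom n)

theorem signedSetAct_act_eq_iff (g : BWn n) (S : Finset (Fin n)) :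
    (signedSetAct n).act g S = S ↔ ∀ i, basePerm g i ∈ S ↔ i ∈ S := setAct_act_eq_iff g S

theorem signedSetAct_wt (g : BWn n) (S : Finset (Fin n)) :
    (signedSetAct n).wt g S = signHom n g * ∏ i ∈ S, coordSign g i := rfl

theorem signedSetAct_wt_mul_self (g : BWn n) (S : Finset (Fin n)) :
    (signedSetAct n).wt g S * (signedSetAct n).wt g S = 1 := by
  have h1 := signHom_mul_self g
  have h2 : (∏ i ∈ S, coordSign g i) * (∏ i ∈ S, coordSign g i) = 1 := setAct_wt_mul_self g S
  rw [signedSetAct_wt]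
  linear_combination (signHom n g * signHom n g) * h2 + h1

theorem signedSetAct_act_mem {c : ℕ} (g : BWn n) {S : Finset (Fin n)}
    (hS : S ∈ powersetCard c univ) : (signedSetAct n).act g S ∈ powersetCard c univ := by
  rw [mem_powersetCard] at hS ⊢
  exact ⟨subset_univ _, (Finset.card_map _).trans hS.2⟩

theorem monAct_act_mem {d : ℕ} (g : BWn n) {m : Fin n → ℕ} (hm : m ∈ piAntidiag univ d) :
    monAct.act g m ∈ piAntidiag univ d := by
  simp only [mem_piAntidiag, mem_univ, implies_true, and_true] at hm ⊢
  exact (Equiv.sum_comp (basePerm g)⁻¹ m).trans hm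

theorem exists_perm_of_card_eq {S T : Finset (Fin n)} (h : S.card = T.card) :
    ∃ q : Perm (Fin n), ∀ i, q i ∈ T ↔ i ∈ S := by
  obtain ⟨q, hq⟩ := exists_perm_comp_eq (fun i => decide (i ∈ T)) (fun i => decide (i ∈ S)) (by
    rintro (_ | _)
    · simp only [decide_eq_false_iff_not]
      have e : ∀ U : Finset (Fin n), (univ.filter fun i => i ∉ U) = Uᶜ := fun U => by ext; simp
      rw [e, e, card_compl, card_compl, h]
    · simp [h])
  exact ⟨q, fun i => by simpa using hq i⟩

theorem prod_coordSign_flipB (i : Fin n) (S : Finset (Fin n)) :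
    ∏ j ∈ S, coordSign (flipB i) j = if i ∈ S then -1 else 1 := by
  simp [coordSign_flipB, Finset.prod_ite_eq']

theorem prod_coordSign_flipB_pow (i : Fin n) (m : Fin n → ℕ) :
    ∏ j, coordSign (flipB i) j ^ m j = (-1) ^ m i := by
  simp [coordSign_flipB, ite_pow, Finset.prod_ite_eq']

theorem isIrrChar_signedSetAct (c : ℕ) (hc : c ≤ n) :
    IsIrrChar ((signedSetAct n).ch (powersetCard c univ)) := by
  classical
  have := Fintype.ofFinite (BWn n)
  refine ⟨SAct.isChar_ch _ _ fun g S hS => signedSetAct_act_mem g hS, ?_⟩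
  rw [cinner_eq_avg _ _ (((signedSetAct n).prod (signedSetAct n)).ch
    (powersetCard c univ ×ˢ powersetCard c univ))]
  · obtain ⟨B₀, hB₀⟩ : (powersetCard c (univ : Finset (Fin n))).Nonempty := by
      rw [powersetCard_nonempty]
      simpa using hc
    refine SAct.avg_ch_eq_one _ _ (B₀, B₀) ?_ ?_ ?_
    · intro g
      exact mem_product.2 ⟨signedSetAct_act_mem g hB₀, signedSetAct_act_mem g hB₀⟩
    · intro g _
      exact signedSetAct_wt_mul_self g B₀
    · rintro ⟨B, B'⟩ hB
      rw [mem_product, mem_powersetCard, mem_powersetCard] at hB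
      rw [mem_powersetCard] at hB₀
      by_cases h : B = B'
      · subst h
        right
        obtain ⟨q, hq⟩ := exists_perm_of_card_eq (hB₀.2.trans hB.1.2.symm)
        refine ⟨permB q, ?_⟩
        have : (signedSetAct n).act (permB q) B₀ = B := by
          change B₀.map q.toEmbedding = B
          ext i
          rw [mem_map_equiv, ← hq, Equiv.apply_symm_apply]
        exact Prod.ext this this
      · left
        have : ∃ i, ¬ (i ∈ B ↔ i ∈ B') := by
          by_contra hc
          push Not at hc
          exact h (Finset.ext hc)
        obtain ⟨i, hi⟩ := this
        refine ⟨flipB i, Prod.ext ?_ ?_, ?_⟩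
        · exact (signedSetAct_act_eq_iff _ _).2 (by simp)
        · exact (signedSetAct_act_eq_iff _ _).2 (by simp)
        · change (signedSetAct n).wt _ B * (signedSetAct n).wt _ B' ≠ 1
          rw [signedSetAct_wt, signedSetAct_wt, prod_coordSign_flipB, prod_coordSign_flipB,
            signHom_apply, basePerm_flipB]
          by_cases h1 : i ∈ B <;> by_cases h2 : i ∈ B' <;> simp_all <;> norm_num
  · intro g
    rw [SAct.ch_prod, SAct.ch_inv _ signedSetAct_wt_mul_self]

theorem blkSub_le_BWn (f : Fin n → ℕ) (ty : Fin n → BTy) : blkSub n f ty ≤ BWn n :=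
  fun _ h => mem_BWn_of_mem_blkSub h

theorem cinner_indChar_sgn_ne_zero (H : Subgroup (PG n)) (hH : H ≤ BWn n) (c : ℕ)
    (B : Finset (Fin n)) (hB : B.card = c)
    (h : ∀ g : BWn n, (g : PG n) ∈ H → ∏ i ∈ Bᶜ, coordSign g i = 1) :
    cinner ((signedSetAct n).ch (powersetCard c univ)) (indChar H (BWn n) (resChar H sgnChar)) ≠
      0 := by
  have := Fintype.ofFinite H
  rw [cinner_indChar H _ hH _ _ (SAct.isChar_ch _ _ fun g S hS => signedSetAct_act_mem g hS)]
  have key : ∀ x : H, (signedSetAct n).ch (powersetCard c univ) (Subgroup.inclusion hH x)⁻¹ *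
      resChar H sgnChar x =
      (((signedSetAct n).twist (sgnHom n)).comap (Subgroup.inclusion hH)).ch
        (powersetCard c univ) x := by
    intro x
    rw [SAct.ch_comap, SAct.ch_twist, SAct.ch_inv _ signedSetAct_wt_mul_self, mul_comm]
    congr 1
    exact sgnChar_eq (Subgroup.inclusion hH x)
  rw [funext key]
  refine SAct.avg_ch_ne_zero _ _ B (mem_powersetCard.2 ⟨subset_univ _, hB⟩) fun x _ => ?_
  change sgnHom n (Subgroup.inclusion hH x) * (signedSetAct n).wt (Subgroup.inclusion hH x) B = 1
  set g := Subgroup.inclusion hH x with hg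
  have h1 := signHom_mul_self g
  have h2 : (∏ i ∈ B, coordSign g i) * (∏ i ∈ B, coordSign g i) = 1 := setAct_wt_mul_self g B
  have h3 := h g x.2
  rw [signedSetAct_wt, sgnHom_apply, ← signHom_apply, ← Finset.prod_mul_prod_compl B, h3]
  linear_combination (signHom n g * signHom n g) * h2 + h1

/-- The polynomial functions tensored with the sign character. -/
def sgnMonAct (n : ℕ) : SAct (BWn n) (Fin n → ℕ) := monAct.twist (sgnHom n)

theorem sgnMonAct_wt (g : BWn n) (m : Fin n → ℕ) :
    (sgnMonAct n).wt g m = sgnHom n g * ∏ i, coordSign g i ^ m i := rfl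

theorem sgnMonAct_act_eq_iff (g : BWn n) (m : Fin n → ℕ) :
    (sgnMonAct n).act g m = m ↔ ∀ i, m (basePerm g i) = m i := monAct_act_eq_iff g m

theorem bMult_sgn (H : Subgroup (PG n)) (hH : H ≤ BWn n) (d : ℕ) :
    bMult (resChar H reflChar) (resChar H sgnChar) d =
      avg (((sgnMonAct n).comap (Subgroup.inclusion hH)).ch (piAntidiag univ d)) := by
  refine cinner_eq_avg _ _ _ fun x => ?_
  rw [SAct.ch_comap, sgnMonAct, SAct.ch_twist, symChar_resChar]
  congr 1
  · exact sgnChar_eq (Subgroup.inclusion hH x)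
  · rw [← SAct.ch_inv _ monAct_wt_mul_self, ← map_inv]
    exact symChar_reflChar (Subgroup.inclusion hH x⁻¹) d

theorem bMult_signedSetAct (c d : ℕ) :
    bMult (resChar (BWn n) reflChar) ((signedSetAct n).ch (powersetCard c univ)) d =
      avg (((signedSetAct n).prod monAct).ch (powersetCard c univ ×ˢ piAntidiag univ d)) := by
  refine cinner_eq_avg _ _ _ fun g => ?_
  rw [SAct.ch_prod, symChar_resChar, symChar_reflChar, SAct.ch_inv _ monAct_wt_mul_self]

end Characters

section Extremal

theorem sum_range_card_le (T : Finset ℕ) :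
    ∑ k ∈ Finset.range T.card, k + (T \ Finset.range T.card).card ≤ ∑ t ∈ T, t := by
  set R := Finset.range T.card with hR
  have hc : (T \ R).card = (R \ T).card := by
    have h1 := Finset.card_sdiff_add_card_inter T R
    have h2 := Finset.card_sdiff_add_card_inter R T
    rw [Finset.inter_comm] at h2
    have h3 : R.card = T.card := card_range _
    omega
  have h1 := Finset.sum_inter_add_sum_sdiff T R (fun x => x)
  have h2 := Finset.sum_inter_add_sum_sdiff R T (fun x => x)
  rw [Finset.inter_comm R T] at h2
  have h3 : (T \ R).card * T.card ≤ ∑ x ∈ T \ R, x := by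
    rw [← smul_eq_mul]
    refine Finset.card_nsmul_le_sum _ _ _ fun x hx => ?_
    rw [mem_sdiff, hR, mem_range] at hx
    omega
  have h4 : ∑ x ∈ R \ T, x + (R \ T).card ≤ (R \ T).card * T.card := by
    rw [Finset.card_eq_sum_ones, ← Finset.sum_add_distrib, ← Finset.card_eq_sum_ones,
      ← smul_eq_mul]
    refine Finset.sum_le_card_nsmul _ _ _ fun x hx => ?_
    rw [mem_sdiff, hR, mem_range] at hx
    omega
  rw [hc] at h3 ⊢
  omega

variable {α : Type*}

theorem card_mul_card_le_sum (I : Finset α) (k : α → ℕ) (hk : Set.InjOn k I) :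
    I.card * I.card ≤ 2 * ∑ i ∈ I, k i + I.card ∧
      (2 * ∑ i ∈ I, k i + I.card ≤ I.card * I.card → ∀ i ∈ I, k i < I.card) := by
  have h1 := sum_range_card_le (I.image k)
  rw [Finset.card_image_of_injOn hk, Finset.sum_image hk] at h1
  have h2 := Finset.sum_range_id_mul_two I.card
  have h3 : I.card * (I.card - 1) + I.card = I.card * I.card := by
    cases I.card with
    | zero => rfl
    | succ a => simp; ring
  refine ⟨by omega, fun h i hi => ?_⟩
  have h4 : (I.image k \ Finset.range I.card).card = 0 := by omega
  rw [Finset.card_eq_zero, Finset.sdiff_eq_empty_iff_subset] at h4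
  exact mem_range.1 (h4 (mem_image_of_mem k hi))

theorem card_mul_card_le_sum_of_parity (I : Finset α) (m : α → ℕ) (hm : Set.InjOn m I) (a : ℕ)
    (ha : ∀ i ∈ I, m i % 2 = a) :
    I.card * I.card + I.card * a ≤ ∑ i ∈ I, m i + I.card ∧
      (∑ i ∈ I, m i + I.card ≤ I.card * I.card + I.card * a → ∀ i ∈ I, m i / 2 < I.card) := by
  have h1 : ∑ i ∈ I, m i = 2 * ∑ i ∈ I, m i / 2 + I.card * a := by
    rw [Finset.mul_sum, ← smul_eq_mul, ← Finset.sum_const, ← Finset.sum_add_distrib]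
    refine Finset.sum_congr rfl fun i hi => ?_
    have := ha i hi
    omega
  have h2 : Set.InjOn (fun i => m i / 2) I := by
    intro i hi j hj hij
    refine hm hi hj ?_
    have h3 := ha i hi
    have h4 := ha j hj
    simp only at hij
    omega
  obtain ⟨h5, h6⟩ := card_mul_card_le_sum I _ h2
  exact ⟨by omega, fun h => h6 (by omega)⟩

end Extremal

section BInvariant

variable {n : ℕ}

theorem sgnMonAct_swap {m : Fin n → ℕ} {i j : Fin n} (hij : i ≠ j) (h : m i = m j) :
    (sgnMonAct n).act (permB (swap i j)) m = m ∧ (sgnMonAct n).wt (permB (swap i j)) m ≠ 1 := by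
  refine ⟨(sgnMonAct_act_eq_iff _ _).2 fun k => ?_, ?_⟩
  · rw [basePerm_permB, swap_apply_def]
    split_ifs with h1 h2
    · rw [h1, h]
    · rw [h2, h]
    · rfl
  · rw [sgnMonAct_wt, sgnHom_apply]
    simp [Perm.sign_swap hij]
    norm_num

theorem sgnMonAct_flip_act (m : Fin n → ℕ) (i : Fin n) : (sgnMonAct n).act (flipB i) m = m :=
  (sgnMonAct_act_eq_iff _ _).2 fun k => by simp

theorem sgnMonAct_flip_wt (m : Fin n → ℕ) (i : Fin n) :
    (sgnMonAct n).wt (flipB i) m = -(-1) ^ m i := by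
  rw [sgnMonAct_wt, sgnHom_apply, prod_coordSign_flipB_pow, prod_coordSign_flipB]
  simp

theorem sgnMonAct_flip_flip (m : Fin n → ℕ) (i j : Fin n) :
    (sgnMonAct n).act (flipB i * flipB j) m = m ∧
      (sgnMonAct n).wt (flipB i * flipB j) m = (-1) ^ (m i + m j) := by
  refine ⟨by rw [SAct.act_mul, sgnMonAct_flip_act, sgnMonAct_flip_act], ?_⟩
  rw [SAct.wt_mul, sgnMonAct_flip_act, sgnMonAct_flip_wt, sgnMonAct_flip_wt, pow_add]
  ring

theorem sgnMonAct_wt_of_injective {m : Fin n → ℕ} (hm : Function.Injective m) {g : BWn n}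
    (hg : (sgnMonAct n).act g m = m) :
    (sgnMonAct n).wt g m = ∏ i, coordSign g i ^ (m i + 1) := by
  have h1 : basePerm g = 1 := Equiv.ext fun i => hm ((sgnMonAct_act_eq_iff g m).1 hg i)
  rw [sgnMonAct_wt, sgnHom_apply, h1, Perm.sign_one, Units.val_one, Int.cast_one, one_mul,
    ← Finset.prod_mul_distrib]
  exact Finset.prod_congr rfl fun i _ => by rw [pow_succ, mul_comm]

theorem isBAt_sgn (H : Subgroup (PG n)) (hH : H ≤ BWn n) (b : ℕ) (m₀ : Fin n → ℕ)
    (hb : ∑ i, m₀ i = b)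
    (h₀ : ∀ g : BWn n, (g : PG n) ∈ H → (sgnMonAct n).act g m₀ = m₀ → (sgnMonAct n).wt g m₀ = 1)
    (h : ∀ m : Fin n → ℕ,
      (∀ g : BWn n, (g : PG n) ∈ H → (sgnMonAct n).act g m = m → (sgnMonAct n).wt g m = 1) →
        b ≤ ∑ i, m i ∧ (∑ i, m i ≤ b → ∃ g : BWn n, (g : PG n) ∈ H ∧ monAct.act g m₀ = m)) :
    IsBAt (resChar H reflChar) (resChar H sgnChar) b ∧
      bMult (resChar H reflChar) (resChar H sgnChar) b = 1 := by
  classical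
  have := Fintype.ofFinite H
  have h1 : bMult (resChar H reflChar) (resChar H sgnChar) b = 1 := by
    rw [bMult_sgn H hH]
    refine SAct.avg_ch_eq_one _ _ m₀ ?_ ?_ ?_
    · exact fun g => monAct_act_mem _ (by simp [mem_piAntidiag, hb])
    · exact fun g hg => h₀ _ g.2 hg
    · intro m hm
      by_cases hgood : ∀ g : BWn n, (g : PG n) ∈ H →
        (sgnMonAct n).act g m = m → (sgnMonAct n).wt g m = 1
      · obtain ⟨g, hgH, hg⟩ := (h m hgood).2 (mem_piAntidiag.1 hm).1.le
        exact Or.inr ⟨⟨g, hgH⟩, hg⟩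
      · push Not at hgood
        obtain ⟨g, hgH, hg⟩ := hgood
        exact Or.inl ⟨⟨g, hgH⟩, hg⟩
  refine ⟨⟨by rw [h1]; exact one_ne_zero, fun d hd => ?_⟩, h1⟩
  rw [bMult_sgn H hH]
  refine SAct.avg_ch_eq_zero _ _ fun m hm => ?_
  by_contra hbad
  push Not at hbad
  have h2 := (h m fun g hgH hg => hbad ⟨g, hgH⟩ hg).1
  rw [(mem_piAntidiag.1 hm).1] at h2
  omega

/-- The elements of `{0, …, n-1}` smaller than `c`. -/
def lowSet (n c : ℕ) : Finset (Fin n) := univ.filter fun i => (i : ℕ) < c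

theorem mem_lowSet {c : ℕ} {i : Fin n} : i ∈ lowSet n c ↔ (i : ℕ) < c := by simp [lowSet]

theorem card_lowSet {c : ℕ} (hn : n = 2 * c + 1) : (lowSet n c).card = c := by
  rw [lowSet, Fin.card_filter_val_lt]
  omega

/-- The exponents `1, 3, …, 2c-1, 0, 2, …, 2c`. -/
def oddEven (n c : ℕ) (i : Fin n) : ℕ := if (i : ℕ) < c then 2 * i + 1 else 2 * (i - c)

theorem oddEven_injective (n c : ℕ) : Function.Injective (oddEven n c) := by
  intro i j h
  unfold oddEven at h
  ext
  split_ifs at h <;> omega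

theorem sum_oddEven {c : ℕ} (hn : n = 2 * c + 1) : ∑ i, oddEven n c i = c * (2 * c + 1) := by
  have h1 : ∀ k, ∑ i ∈ Finset.range k, (2 * i + 1) = k * k := fun k => by
    induction k with
    | zero => rfl
    | succ k ih => rw [Finset.sum_range_succ, ih]; ring
  have h2 : ∀ k, ∑ i ∈ Finset.range (k + 1), 2 * i = k * (k + 1) := fun k => by
    induction k with
    | zero => rfl
    | succ k ih => rw [Finset.sum_range_succ, ih]; ring
  have h3 : ∑ i, oddEven n c i =
      ∑ i ∈ Finset.range n, if i < c then 2 * i + 1 else 2 * (i - c) :=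
    Fin.sum_univ_eq_sum_range (fun i => if i < c then 2 * i + 1 else 2 * (i - c)) n
  rw [h3, show n = c + (c + 1) by omega, Finset.sum_range_add,
    Finset.sum_congr rfl fun i hi => if_pos (mem_range.1 hi), h1,
    Finset.sum_congr rfl fun i _ => (if_neg (by omega) : _ = 2 * (c + i - c))]
  simp only [Nat.add_sub_cancel_left]
  rw [h2]
  ring

theorem isBAt_signedSetAct {c : ℕ} (hn : n = 2 * c + 1) :
    IsBAt (resChar (BWn n) reflChar) ((signedSetAct n).ch (powersetCard c univ))
      (c * (2 * c + 1)) := by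
  classical
  have := Fintype.ofFinite (BWn n)
  constructor
  · rw [bMult_signedSetAct]
    refine SAct.avg_ch_ne_zero _ _ (lowSet n c, oddEven n c) ?_ fun g hg => ?_
    · simp [mem_piAntidiag, sum_oddEven hn, card_lowSet hn]
    · have h1 : basePerm g = 1 :=
        Equiv.ext fun i => oddEven_injective n c
          ((monAct_act_eq_iff g (oddEven n c)).1 (Prod.ext_iff.1 hg).2 i)
      change (signedSetAct n).wt g (lowSet n c) * ∏ i, coordSign g i ^ oddEven n c i = 1
      rw [signedSetAct_wt, signHom_apply, h1, Perm.sign_one, Units.val_one, Int.cast_one, one_mul,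
        lowSet, Finset.prod_filter, ← Finset.prod_mul_distrib]
      refine Finset.prod_eq_one fun i _ => ?_
      have h2 := coordSign_mul_self g i
      unfold oddEven
      split_ifs
      · rw [← pow_succ', show 2 * (i : ℕ) + 1 + 1 = 2 * (i + 1) by ring, pow_mul, sq, h2, one_pow]
      · rw [one_mul, pow_mul, sq, h2, one_pow]
  · intro d hd
    rw [bMult_signedSetAct]
    refine SAct.avg_ch_eq_zero _ _ ?_
    rintro ⟨B, m⟩ hBm
    rw [mem_product, mem_powersetCard, mem_piAntidiag] at hBm
    obtain ⟨⟨-, hB⟩, hm, -⟩ := hBm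
    by_contra hbad
    push Not at hbad
    have hpar : ∀ i, m i % 2 = if i ∈ B then 1 else 0 := by
      intro i
      have h1 := hbad (flipB i) (Prod.ext ((signedSetAct_act_eq_iff _ _).2 (by simp))
        ((monAct_act_eq_iff _ _).2 (by simp)))
      change (signedSetAct n).wt (flipB i) B * ∏ j, coordSign (flipB i) j ^ m j = 1 at h1
      rw [signedSetAct_wt, prod_coordSign_flipB, prod_coordSign_flipB_pow, signHom_apply,
        basePerm_flipB] at h1
      rcases Nat.even_or_odd (m i) with he | ho
      · rw [he.neg_one_pow] at h1
        rw [Nat.even_iff.1 he]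
        split_ifs at h1 ⊢
        · norm_num at h1
        · rfl
      · rw [ho.neg_one_pow] at h1
        rw [Nat.odd_iff.1 ho]
        split_ifs at h1 ⊢
        · rfl
        · norm_num at h1
    have hinj : Function.Injective m := by
      intro i j hij
      by_contra hne
      have hmem : i ∈ B ↔ j ∈ B := by
        have h1 := hpar i
        rw [hij, hpar j] at h1
        by_cases h2 : i ∈ B <;> by_cases h3 : j ∈ B <;> simp_all
      have h1 := hbad (permB (swap i j))
        (Prod.ext ((signedSetAct_act_eq_iff _ _).2 fun k => by
            rw [basePerm_permB, swap_apply_def]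
            split_ifs with h1 h2
            · rw [h1, hmem]
            · rw [h2, hmem]
            · rfl)
          ((sgnMonAct_act_eq_iff _ _).1 (sgnMonAct_swap hne hij).1 |> (monAct_act_eq_iff _ _).2))
      change (signedSetAct n).wt (permB (swap i j)) B *
        ∏ k, coordSign (permB (swap i j)) k ^ m k = 1 at h1
      rw [signedSetAct_wt, signHom_apply] at h1
      simp [Perm.sign_swap hne] at h1
      norm_num at h1
    have h1 := (card_mul_card_le_sum_of_parity B m hinj.injOn 1
      fun i hi => by rw [hpar, if_pos hi]).1
    have h2 := (card_mul_card_le_sum_of_parity Bᶜ m hinj.injOn 0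
      fun i hi => by rw [hpar, if_neg (mem_compl.1 hi)]).1
    have h3 := Finset.sum_add_sum_compl B m
    have h4 : Bᶜ.card = c + 1 := by rw [card_compl, hB, Fintype.card_fin]; omega
    rw [hB] at h1
    rw [h4] at h2
    nlinarith

theorem isBAt_sgn_symmetric {c : ℕ} (hn : n = 2 * c + 1) :
    IsBAt (resChar (blkSub n (fun _ => 0) (fun _ => BTy.S)) reflChar)
        (resChar (blkSub n (fun _ => 0) (fun _ => BTy.S)) sgnChar) (c * (2 * c + 1)) ∧
      bMult (resChar (blkSub n (fun _ => 0) (fun _ => BTy.S)) reflChar)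
        (resChar (blkSub n (fun _ => 0) (fun _ => BTy.S)) sgnChar) (c * (2 * c + 1)) = 1 := by
  refine isBAt_sgn _ (blkSub_le_BWn _ _) _ (fun i => (i : ℕ)) ?_ ?_ ?_
  · have h1 := Finset.sum_range_id_mul_two n
    rw [Fin.sum_univ_eq_sum_range (fun i => i) n]
    rw [hn] at h1 ⊢
    rw [Nat.add_sub_cancel] at h1
    linarith
  · intro g hgH hg
    rw [sgnMonAct_wt_of_injective (fun i j h => Fin.ext h) hg]
    exact Finset.prod_eq_one fun i _ => by rw [coordSign_eq_one_of_mem_S g hgH, one_pow]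
  · intro m hm
    have hinj : Function.Injective m := by
      intro i j hij
      by_contra hne
      have h1 := sgnMonAct_swap hne hij
      exact h1.2 (hm _ (liftPerm_mem_blkSub _ _ _ fun _ => rfl) h1.1)
    obtain ⟨h1, h2⟩ := card_mul_card_le_sum univ m hinj.injOn
    rw [card_univ, Fintype.card_fin] at h1 h2
    have h3 : n * n = 2 * (c * (2 * c + 1)) + n := by rw [hn]; ring
    refine ⟨by omega, fun hle => ?_⟩
    have hlt : ∀ i, m i < n := fun i => h2 (by omega) i (mem_univ i)
    let q : Perm (Fin n) := Equiv.ofBijective (fun i => ⟨m i, hlt i⟩)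
      (Finite.injective_iff_bijective.1 fun i j h => hinj (Fin.ext_iff.1 h))
    refine ⟨permB q⁻¹, liftPerm_mem_blkSub _ _ _ fun _ => rfl, funext fun i => ?_⟩
    change (((q⁻¹)⁻¹ i : Fin n) : ℕ) = m i
    rw [inv_inv]
    rfl

/-- The type of an index in the subgroup `W_c × W'_{n-c}`. -/
def mixTy (n c : ℕ) (i : Fin n) : BTy := if (i : ℕ) < c then BTy.B else BTy.D

theorem flipB_mem_mixed {c : ℕ} (f : Fin n → ℕ) {i : Fin n} (hi : (i : ℕ) < c) :
    (flipB i : PG n) ∈ blkSub n f (mixTy n c) :=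
  ssw_mem_blkSub (if_pos hi)

theorem flipB_mul_flipB_mem_mixed {c : ℕ} {f : Fin n → ℕ} {i j : Fin n} (hij : i ≠ j)
    (hf : f i = f j) (hi : ¬ (i : ℕ) < c) (hj : ¬ (j : ℕ) < c) :
    ((flipB i * flipB j : BWn n) : PG n) ∈ blkSub n f (mixTy n c) := by
  have h1 : msw i j ∈ blkSub n f (mixTy n c) := msw_mem_blkSub hf (if_neg hi) (if_neg hj)
  rw [msw_eq i j hij] at h1
  exact (Subgroup.mul_mem_cancel_left _ (dsw_mem_blkSub hf)).1 h1

theorem prod_compl_lowSet_eq_one {c : ℕ} {f : Fin n → ℕ}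
    (hf : ∀ i j : Fin n, f i = f j ↔ ((i : ℕ) < c ↔ (j : ℕ) < c)) (g : BWn n)
    (hg : (g : PG n) ∈ blkSub n f (mixTy n c)) : ∏ i ∈ (lowSet n c)ᶜ, coordSign g i = 1 := by
  refine prod_coordSign_eq_one_of_mem f (mixTy n c) _ (fun i j hij => ?_) (fun i hi => ?_) g hg
  · rw [mem_compl, mem_compl, mem_lowSet, mem_lowSet, (hf i j).1 hij]
  · rw [mem_compl, mem_lowSet] at hi
    rw [mixTy, if_neg hi]
    exact nofun

theorem isBAt_sgn_mixed {c : ℕ} (hn : n = 2 * c + 1) (f : Fin n → ℕ)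
    (hf : ∀ i j : Fin n, f i = f j ↔ ((i : ℕ) < c ↔ (j : ℕ) < c)) :
    IsBAt (resChar (blkSub n f (mixTy n c)) reflChar) (resChar (blkSub n f (mixTy n c)) sgnChar)
        (c * (2 * c + 1)) ∧
      bMult (resChar (blkSub n f (mixTy n c)) reflChar) (resChar (blkSub n f (mixTy n c)) sgnChar)
        (c * (2 * c + 1)) = 1 := by
  refine isBAt_sgn _ (blkSub_le_BWn _ _) _ (oddEven n c) (sum_oddEven hn) ?_ ?_
  · intro g hgH hg
    rw [sgnMonAct_wt_of_injective (oddEven_injective n c) hg,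
      ← prod_compl_lowSet_eq_one hf g hgH, lowSet, Finset.compl_filter, Finset.prod_filter]
    refine Finset.prod_congr rfl fun i _ => ?_
    have h2 := coordSign_mul_self g i
    by_cases hi : (i : ℕ) < c
    · rw [oddEven, if_pos hi, if_neg (not_not.2 hi), show 2 * (i : ℕ) + 1 + 1 = 2 * (i + 1) by ring,
        pow_mul, sq, h2, one_pow]
    · rw [oddEven, if_neg hi, if_pos hi, pow_succ, pow_mul, sq, h2, one_pow, one_mul]
  · intro m hm
    have hinj : ∀ i j : Fin n, ((i : ℕ) < c ↔ (j : ℕ) < c) → m i = m j → i = j := by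
      intro i j hij hmij
      by_contra hne
      have h1 := sgnMonAct_swap hne hmij
      refine h1.2 (hm _ ?_ h1.1)
      change liftPerm (swap i j) ∈ _
      rw [← dsw_eq_liftPerm]
      exact dsw_mem_blkSub ((hf i j).2 hij)
    have hodd : ∀ i : Fin n, (i : ℕ) < c → m i % 2 = 1 := by
      intro i hi
      have h1 := hm _ (flipB_mem_mixed f hi) (sgnMonAct_flip_act m i)
      rw [sgnMonAct_flip_wt] at h1
      by_contra hne
      rw [(Nat.even_iff.2 (by omega) : Even (m i)).neg_one_pow] at h1
      norm_num at h1
    have hpar : ∀ i j : Fin n, ¬ (i : ℕ) < c → ¬ (j : ℕ) < c → m i % 2 = m j % 2 := by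
      intro i j hi hj
      by_cases hij : i = j
      · rw [hij]
      obtain ⟨h1, h2⟩ := sgnMonAct_flip_flip m i j
      have h3 := hm _ (flipB_mul_flipB_mem_mixed hij ((hf i j).2 (by tauto)) hi hj) h1
      rw [h2] at h3
      by_contra hne
      rw [(Nat.odd_iff.2 (by omega) : Odd (m i + m j)).neg_one_pow] at h3
      norm_num at h3
    obtain ⟨h1, h1'⟩ := card_mul_card_le_sum_of_parity (lowSet n c) m
      (fun i hi j hj => hinj i j (by
        rw [← mem_lowSet, ← mem_lowSet]
        exact iff_of_true hi hj)) 1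
      fun i hi => hodd i (mem_lowSet.1 hi)
    obtain ⟨h2, h2'⟩ := card_mul_card_le_sum_of_parity (lowSet n c)ᶜ m
      (fun i hi j hj => hinj i j (by
        rw [← not_iff_not, ← mem_lowSet, ← mem_lowSet, ← mem_compl, ← mem_compl]
        exact iff_of_true hi hj)) (m ⟨c, by omega⟩ % 2)
      fun i hi => hpar _ _ (fun h => mem_compl.1 hi (mem_lowSet.2 h)) (lt_irrefl c)
    set a := m ⟨c, by omega⟩ % 2 with ha
    have h3 := Finset.sum_add_sum_compl (lowSet n c) m
    have h4 : (lowSet n c)ᶜ.card = c + 1 := by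
      rw [card_compl, card_lowSet hn, Fintype.card_fin]; omega
    rw [card_lowSet hn] at h1 h1'
    rw [h4] at h2 h2'
    have h5 : (c + 1) * (c + 1) = c * c + c + (c + 1) := by ring
    have h6 : c * (2 * c + 1) = 2 * (c * c) + c := by ring
    refine ⟨by omega, fun hle => ?_⟩
    have ha0 : a = 0 := by
      by_contra hne
      have : (c + 1) * a = c + 1 := by rw [show a = 1 by omega, mul_one]
      omega
    rw [ha0, mul_zero] at h2 h2'
    have hlow : ∀ i : Fin n, (i : ℕ) < c → m i / 2 < c := fun i hi =>
      h1' (by omega) i (mem_lowSet.2 hi)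
    have hhigh : ∀ i : Fin n, ¬ (i : ℕ) < c → m i / 2 < c + 1 := fun i hi =>
      h2' (by omega) i (mem_compl.2 fun h => hi (mem_lowSet.1 h))
    have heven : ∀ i : Fin n, ¬ (i : ℕ) < c → m i % 2 = 0 := fun i hi =>
      (hpar i ⟨c, by omega⟩ hi (lt_irrefl c)).trans ha0
    let q₀ : Fin n → Fin n := fun i =>
      if hi : (i : ℕ) < c then ⟨m i / 2, by have := hlow i hi; omega⟩
      else ⟨c + m i / 2, by have := hhigh i hi; omega⟩
    have hq₀ : ∀ i, ((q₀ i : ℕ) < c ↔ (i : ℕ) < c) ∧ oddEven n c (q₀ i) = m i := by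
      intro i
      by_cases hi : (i : ℕ) < c
      · have e : (q₀ i : ℕ) = m i / 2 := by simp only [q₀, dif_pos hi]
        have h7 := hlow i hi
        have h8 := hodd i hi
        refine ⟨iff_of_true (by omega) hi, ?_⟩
        rw [oddEven, if_pos (by omega)]
        omega
      · have e : (q₀ i : ℕ) = c + m i / 2 := by simp only [q₀, dif_neg hi]
        have h7 := heven i hi
        refine ⟨iff_of_false (by omega) hi, ?_⟩
        rw [oddEven, if_neg (by omega)]
        omega
    let q : Perm (Fin n) := Equiv.ofBijective q₀ (Finite.injective_iff_bijective.1 fun i j h =>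
      hinj i j (by rw [← (hq₀ i).1, h, (hq₀ j).1]) (by rw [← (hq₀ i).2, h, (hq₀ j).2]))
    refine ⟨permB q⁻¹, liftPerm_mem_blkSub _ _ _ fun i => (hf _ _).2 ?_, funext fun i => ?_⟩
    · have h7 := (hq₀ (q⁻¹ i)).1
      change ((q (q⁻¹ i) : ℕ) < c ↔ _) at h7
      rw [apply_inv_apply] at h7
      exact h7.symm
    · change oddEven n c ((q⁻¹)⁻¹ i) = m i
      rw [inv_inv]
      exact (hq₀ i).2

theorem blockOf_two_eq_iff {c : ℕ} (hn : n = 2 * c + 1) (i j : Fin n) :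
    blockOf 2 (fun b => if b = 0 then c else c + 1) (i : ℕ) =
      blockOf 2 (fun b => if b = 0 then c else c + 1) (j : ℕ) ↔
        ((i : ℕ) < c ↔ (j : ℕ) < c) := by
  have key : ∀ k : Fin n, blockOf 2 (fun b => if b = 0 then c else c + 1) (k : ℕ) =
      if (k : ℕ) < c then 0 else 1 := by
    intro k
    split_ifs with h
    · exact blockOf_eq (by omega) (by simp) (by simpa using h)
    · refine blockOf_eq (by omega) (by simpa using h) ?_
      simp [Finset.sum_range_succ]
      omega
  rw [key, key]
  by_cases h1 : (i : ℕ) < c <;> by_cases h2 : (j : ℕ) < c <;> simp [h1, h2]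

end BInvariant

/-- 3.2(b): in the hyperoctahedral group `W_n` with `n = 2c+1`,
the `j`-induction of the sign representation from the reflection subgroup
`W_c × W'_{c+1}` equals the `j`-induction of the sign representation from `S_n`, and
both equal the irreducible representation with symbol
`[(1 < 2 < … < c+1), (1 < 2 < … < c)]`. -/
theorem stmt11 (c n : ℕ) (hn : n = 2 * c + 1) :
    IsJInd (reflChar (n := n))
      (blkSub n (fun i => blockOf 2 (fun b => if b = 0 then c else c + 1) (i : ℕ))
        (fun i => if (i : ℕ) < c then BTy.B else BTy.D))
      (BWn n) (resChar _ sgnChar)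
      (chiBSymbol n c (fun t => (t : ℕ) + 1) (fun t => (t : ℕ) + 1)) ∧
    IsJInd (reflChar (n := n))
      (blkSub n (fun _ => 0) (fun _ => BTy.S))
      (BWn n) (resChar _ sgnChar)
      (chiBSymbol n c (fun t => (t : ℕ) + 1) (fun t => (t : ℕ) + 1)) := by
  have hχ : chiBSymbol n c (fun t => (t : ℕ) + 1) (fun t => (t : ℕ) + 1) =
      (signedSetAct n).ch (powersetCard c univ) := funext fun g => by
    rw [chiBSymbol_eq c hn, signedSetAct, SAct.ch_twist, signHom_apply]
  rw [hχ]
  have hirr := isIrrChar_signedSetAct (n := n) c (by omega)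
  have hmix := isBAt_sgn_mixed hn _ (blockOf_two_eq_iff hn)
  have hsym := isBAt_sgn_symmetric hn
  exact ⟨⟨hirr, cinner_indChar_sgn_ne_zero _ (blkSub_le_BWn _ _) c _ (card_lowSet hn)
      (prod_compl_lowSet_eq_one (blockOf_two_eq_iff hn)), _, hmix.1, hmix.2, isBAt_signedSetAct hn⟩,
    ⟨hirr, cinner_indChar_sgn_ne_zero _ (blkSub_le_BWn _ _) c _ (card_lowSet hn)
      fun g hg => Finset.prod_eq_one fun i _ => coordSign_eq_one_of_mem_S g hg i,
      _, hsym.1, hsym.2, isBAt_signedSetAct hn⟩⟩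

end

end CS
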